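/- arXiv:1710.09546 — 4 statements merged into one kernel-verified Lean document; each statement's English description precedes it below -/
import Mathlib

section
/- Under the flow, differentiating the Neumann boundary condition in time yields F_s(±1, t) = 0 for all t ∈ [0,T); equivalently, at both endpoints x = ±1 one has k_{s⁵} + k k_s k_{ss} + k² k_{sss} − (1/2) k_s³ = 0. -/
noncomputable section

open Real Set MeasureTheory intervalIntegral
open scoped ENNReal RealInnerProductSpace

/-- The Euclidean plane. -/
abbrev E2 : Type := EuclideanSpace ℝ (Fin 2)

/-- Counterclockwise rotation by `π/2`. -/
def rot (v : E2) : E2 := (WithLp.equiv 2 (Fin 2 → ℝ)).symm ![-(v 1), v 0]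

/-- Arc length derivative `∂ₛ = |∂ₓγ|⁻¹ ∂ₓ` of a scalar function along the curve `γ`. -/
def aderiv (γ : ℝ → E2) (f : ℝ → ℝ) (x : ℝ) : ℝ := (‖deriv γ x‖)⁻¹ * deriv f x

/-- Iterated arc length derivative. -/
def aderivIter (γ : ℝ → E2) : ℕ → (ℝ → ℝ) → (ℝ → ℝ)
  | 0, f => f
  | n + 1, f => aderiv γ (aderivIter γ n f)

/-- Arc length derivative of a vector-valued function along `γ`. -/
def aderivVec (γ : ℝ → E2) (f : ℝ → E2) (x : ℝ) : E2 := (‖deriv γ x‖)⁻¹ • deriv f x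

/-- Unit tangent vector `τ = ∂ₛ γ`. -/
def utangent (γ : ℝ → E2) (x : ℝ) : E2 := aderivVec γ γ x

/-- Unit normal `ν`, the counterclockwise rotation of `τ` by `π/2`. -/
def unormal (γ : ℝ → E2) (x : ℝ) : E2 := rot (utangent γ x)

/-- Scalar curvature `k = ⟨∂ₛτ, ν⟩`. -/
def curv (γ : ℝ → E2) (x : ℝ) : ℝ := ⟪aderivVec γ (utangent γ) x, unormal γ x⟫

/-- `j`-th arc length derivative of the curvature, `k_{s^j}`. -/
def kds (γ : ℝ → E2) (j : ℕ) : ℝ → ℝ := aderivIter γ j (curv γ)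

/-- The normal speed `F = k_{s⁴} + k² k_{ss} - (1/2) k k_s²`. -/
def speedF (γ : ℝ → E2) (x : ℝ) : ℝ :=
  kds γ 4 x + (curv γ x) ^ 2 * kds γ 2 x - (1 / 2) * curv γ x * (kds γ 1 x) ^ 2

/-- `∫_γ f ds`, the integral of `f` along `γ : [-1,1] → ℝ²` with respect to arc length. -/
def cint (γ : ℝ → E2) (f : ℝ → ℝ) : ℝ := ∫ x in (-1:ℝ)..1, f x * ‖deriv γ x‖

/-- The length of `γ`. -/
def clen (γ : ℝ → E2) : ℝ := cint γ (fun _ => 1)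

/-- `‖k_{s^j}‖₂² = ∫_γ k_{s^j}² ds`. -/
def knorm2 (γ : ℝ → E2) (j : ℕ) : ℝ := cint γ (fun x => (kds γ j x) ^ 2)

/-- Total curvature `∫_γ k ds`. -/
def totalK (γ : ℝ → E2) : ℝ := cint γ (curv γ)

/-- The time interval `[0, T)`, `T ∈ (0, ∞]`. -/
def inTime (T : ℝ≥0∞) (t : ℝ) : Prop := 0 ≤ t ∧ ENNReal.ofReal t < T

/-- A smooth family of regular plane curves `γ : [-1,1] × [0,T) → ℝ²` moving with
normal speed `F = k_{s⁴} + k² k_{ss} - (1/2) k k_s²`, i.e. `∂ₜγ = F ν`. -/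
structure SixthFlow (T : ℝ≥0∞) where
  Tpos : 0 < T
  γ : ℝ → ℝ → E2
  smooth : ContDiff ℝ (⊤ : ℕ∞) (Function.uncurry γ)
  regular : ∀ ⦃t x : ℝ⦄, inTime T t → x ∈ Icc (-1:ℝ) 1 → deriv (γ t) x ≠ 0
  flow : ∀ ⦃t x : ℝ⦄, inTime T t → x ∈ Icc (-1:ℝ) 1 →
    HasDerivWithinAt (fun u => γ u x) (speedF (γ t) x • unormal (γ t) x) (Ici 0) t

/-- The boundary conditions: the endpoints of the curve lie on two fixed parallel vertical
lines at distance `|e| > 0` (at abscissae `lineMinus` and `linePlus`), the curve meets these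
lines perpendicularly (Neumann condition: the unit normal of the curve is orthogonal to the
unit normal `(1,0)` of the lines), and `k_s = k_{sss} = 0` at both endpoints. -/
structure BC {T : ℝ≥0∞} (Φ : SixthFlow T) (e : ℝ) where
  he : e ≠ 0
  lineMinus : ℝ
  linePlus : ℝ
  hdist : |linePlus - lineMinus| = |e|
  onLeft : ∀ ⦃t : ℝ⦄, inTime T t → Φ.γ t (-1) 0 = lineMinus
  onRight : ∀ ⦃t : ℝ⦄, inTime T t → Φ.γ t 1 0 = linePlus
  neumann : ∀ ⦃t : ℝ⦄, inTime T t →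
    unormal (Φ.γ t) (-1) 0 = 0 ∧ unormal (Φ.γ t) 1 0 = 0
  noflux : ∀ ⦃t : ℝ⦄, inTime T t →
    kds (Φ.γ t) 1 (-1) = 0 ∧ kds (Φ.γ t) 1 1 = 0
  noflux3 : ∀ ⦃t : ℝ⦄, inTime T t →
    kds (Φ.γ t) 3 (-1) = 0 ∧ kds (Φ.γ t) 3 1 = 0

theorem ContDiffAt.deriv_of_top {E : Type*} [NormedAddCommGroup E] [NormedSpace ℝ E]
    {f : ℝ → E} {x : ℝ} (hf : ContDiffAt ℝ (⊤ : ℕ∞) f x) :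
    ContDiffAt ℝ (⊤ : ℕ∞) (deriv f) x := by
  have h : ContDiffAt ℝ (⊤ : ℕ∞) (fderiv ℝ f) x := hf.fderiv_right (by simp)
  exact h.clm_apply contDiffAt_const

theorem contDiffAt_inv_norm_deriv {γ : ℝ → E2} {x : ℝ} (hγ : ContDiffAt ℝ (⊤ : ℕ∞) γ x)
    (hx : deriv γ x ≠ 0) : ContDiffAt ℝ (⊤ : ℕ∞) (fun y => (‖deriv γ y‖)⁻¹) x :=
  (hγ.deriv_of_top.norm ℝ hx).inv (norm_ne_zero_iff.mpr hx)

theorem contDiffAt_aderiv {γ : ℝ → E2} {f : ℝ → ℝ} {x : ℝ}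
    (hγ : ContDiffAt ℝ (⊤ : ℕ∞) γ x) (hx : deriv γ x ≠ 0)
    (hf : ContDiffAt ℝ (⊤ : ℕ∞) f x) : ContDiffAt ℝ (⊤ : ℕ∞) (aderiv γ f) x :=
  (contDiffAt_inv_norm_deriv hγ hx).mul hf.deriv_of_top

theorem contDiffAt_aderivVec {γ : ℝ → E2} {f : ℝ → E2} {x : ℝ}
    (hγ : ContDiffAt ℝ (⊤ : ℕ∞) γ x) (hx : deriv γ x ≠ 0)
    (hf : ContDiffAt ℝ (⊤ : ℕ∞) f x) : ContDiffAt ℝ (⊤ : ℕ∞) (aderivVec γ f) x :=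
  (contDiffAt_inv_norm_deriv hγ hx).smul hf.deriv_of_top

theorem contDiffAt_utangent {γ : ℝ → E2} {x : ℝ}
    (hγ : ContDiffAt ℝ (⊤ : ℕ∞) γ x) (hx : deriv γ x ≠ 0) :
    ContDiffAt ℝ (⊤ : ℕ∞) (utangent γ) x :=
  contDiffAt_aderivVec hγ hx hγ

theorem rot_apply_zero (v : E2) : rot v 0 = -(v 1) := rfl

theorem ContDiffAt.rot {f : ℝ → E2} {x : ℝ} (hf : ContDiffAt ℝ (⊤ : ℕ∞) f x) :
    ContDiffAt ℝ (⊤ : ℕ∞) (fun y => rot (f y)) x := by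
  rw [contDiffAt_euclidean] at hf ⊢
  intro i
  fin_cases i
  · exact (hf 1).neg
  · exact hf 0

theorem contDiffAt_curv {γ : ℝ → E2} {x : ℝ}
    (hγ : ContDiffAt ℝ (⊤ : ℕ∞) γ x) (hx : deriv γ x ≠ 0) :
    ContDiffAt ℝ (⊤ : ℕ∞) (curv γ) x :=
  (contDiffAt_aderivVec hγ hx (contDiffAt_utangent hγ hx)).inner ℝ (contDiffAt_utangent hγ hx).rot

theorem contDiffAt_kds {γ : ℝ → E2} {x : ℝ}
    (hγ : ContDiffAt ℝ (⊤ : ℕ∞) γ x) (hx : deriv γ x ≠ 0) (j : ℕ) :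
    ContDiffAt ℝ (⊤ : ℕ∞) (kds γ j) x := by
  induction j with
  | zero => exact contDiffAt_curv hγ hx
  | succ j ih => exact contDiffAt_aderiv hγ hx ih

theorem hasDerivAt_speedF {γ : ℝ → E2} {x : ℝ}
    (hγ : ContDiffAt ℝ (⊤ : ℕ∞) γ x) (hx : deriv γ x ≠ 0) :
    HasDerivAt (speedF γ) (deriv (speedF γ) x) x ∧
    aderiv γ (speedF γ) x = kds γ 5 x + curv γ x * kds γ 1 x * kds γ 2 x
      + (curv γ x) ^ 2 * kds γ 3 x - (1 / 2) * (kds γ 1 x) ^ 3 := by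
  have hk (j : ℕ) : HasDerivAt (kds γ j) (deriv (kds γ j) x) x :=
    ((contDiffAt_kds hγ hx j).differentiableAt (by simp)).hasDerivAt
  have hF := ((hk 4).add (((hk 0).pow 2).mul (hk 2))).sub
    (((hk 0).const_mul (1 / 2)).mul ((hk 1).pow 2))
  have hF' : HasDerivAt (speedF γ) _ x := hF
  refine ⟨hF'.differentiableAt.hasDerivAt, ?_⟩
  have hs (j : ℕ) : kds γ (j + 1) x = (‖deriv γ x‖)⁻¹ * deriv (kds γ j) x := rfl
  have h0 : curv γ = kds γ 0 := rfl
  rw [aderiv, hF'.deriv, h0, hs 4, hs 2]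
  have h1 := hs 0
  have h2 := hs 1
  norm_num at h1 h2 ⊢
  rw [h2, h1]
  ring

/-- At a point where the unit tangent is horizontal, the horizontal component of the unit tangent
is stationary and nonzero. -/
theorem hasDerivAt_utangent_zero {γ : ℝ → E2} {x : ℝ}
    (hγ : ContDiffAt ℝ (⊤ : ℕ∞) γ x) (hx : deriv γ x ≠ 0) (h1 : utangent γ x 1 = 0) :
    HasDerivAt (fun y => utangent γ y 0) 0 x ∧ utangent γ x 0 ≠ 0 := by
  have hτ := contDiffAt_utangent hγ hx
  rw [contDiffAt_euclidean] at hτ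
  have hd (i : Fin 2) := ((hτ i).differentiableAt (by simp)).hasDerivAt
  have hunit : ∀ y, deriv γ y ≠ 0 → (utangent γ y 0) ^ 2 + (utangent γ y 1) ^ 2 = 1 := by
    intro y hy
    have hn : ‖utangent γ y‖ = 1 := by
      simp [utangent, aderivVec, norm_smul, hy]
    have := EuclideanSpace.norm_sq_eq (utangent γ y)
    rw [hn, Fin.sum_univ_two] at this
    simpa using this.symm
  have hne : utangent γ x 0 ≠ 0 := by
    intro h0
    have := hunit x hx
    simp [h0, h1] at this
  have hev : (fun y => (utangent γ y 0) ^ 2 + (utangent γ y 1) ^ 2) =ᶠ[nhds x] fun _ => 1 := by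
    filter_upwards [hγ.deriv_of_top.continuousAt.eventually_ne hx] with y hy using hunit y hy
  have hc := (((hd 0).pow 2).add ((hd 1).pow 2)).unique
    ((hasDerivAt_const x (1 : ℝ)).congr_of_eventuallyEq hev)
  have hz : deriv (fun y => utangent γ y 0) x = 0 := by
    simpa [h1, hne] using hc
  exact ⟨hz ▸ hd 0, hne⟩

theorem hasDerivAt_fderiv_apply_comm {g : ℝ × ℝ → ℝ} (hg : ContDiff ℝ (⊤ : ℕ∞) g) (t x : ℝ) :
    ∃ d : ℝ, HasDerivAt (fun u => fderiv ℝ g (u, x) (0, 1)) d t ∧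
      HasDerivAt (fun y => fderiv ℝ g (t, y) (1, 0)) d x := by
  have hd : HasFDerivAt (fderiv ℝ g) (fderiv ℝ (fderiv ℝ g) (t, x)) (t, x) :=
    ((hg.fderiv_right (m := 1) (by norm_cast)).differentiable (by simp) _).hasFDerivAt
  have hsymm : IsSymmSndFDerivAt ℝ g (t, x) := hg.contDiffAt.isSymmSndFDerivAt (by simp; norm_cast)
  refine ⟨fderiv ℝ (fderiv ℝ g) (t, x) (1, 0) (0, 1), ?_, ?_⟩
  · have hp : HasDerivAt (fun u : ℝ => (u, x)) ((1 : ℝ), (0 : ℝ)) t :=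
      (hasDerivAt_id t).prodMk (hasDerivAt_const t x)
    exact ((ContinuousLinearMap.apply ℝ ℝ ((0 : ℝ), (1 : ℝ))).hasFDerivAt.comp_hasDerivAt t
      (hd.comp_hasDerivAt t hp))
  · have hp : HasDerivAt (fun y : ℝ => (t, y)) ((0 : ℝ), (1 : ℝ)) x :=
      (hasDerivAt_const x t).prodMk (hasDerivAt_id x)
    rw [hsymm.eq]
    exact ((ContinuousLinearMap.apply ℝ ℝ ((1 : ℝ), (0 : ℝ))).hasFDerivAt.comp_hasDerivAt x
      (hd.comp_hasDerivAt x hp))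

theorem eventually_inTime {T : ℝ≥0∞} {t : ℝ} (ht : inTime T t) :
    ∀ᶠ u in nhdsWithin t (Ici t), inTime T u := by
  have h : ∀ᶠ u in nhds t, ENNReal.ofReal u < T :=
    ENNReal.continuous_ofReal.continuousAt.eventually_lt_const ht.2
  filter_upwards [nhdsWithin_le_nhds h, self_mem_nhdsWithin] with u hu hu'
  exact ⟨ht.1.trans hu', hu⟩

theorem HasDerivWithinAt.apply_one {f : ℝ → E2} {v : E2} {s : Set ℝ} {x : ℝ}
    (h : HasDerivWithinAt f v s x) : HasDerivWithinAt (fun y => f y 1) (v 1) s x :=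
  (EuclideanSpace.proj (1 : Fin 2) : E2 →L[ℝ] ℝ).hasFDerivAt.comp_hasDerivWithinAt x h

/-- **Differentiated Neumann condition.**  Under the flow with the stated boundary
conditions, `F_s(±1, t) = 0` for all `t ∈ [0,T)`; equivalently, at both endpoints
`k_{s⁵} + k k_s k_{ss} + k² k_{sss} - (1/2) k_s³ = 0`. -/
theorem boundary_Fs_zero {T : ℝ≥0∞} (Φ : SixthFlow T) (e : ℝ) (B : BC Φ e)
    {t : ℝ} (ht : inTime T t) {x : ℝ} (hx : x = -1 ∨ x = 1) :
    aderiv (Φ.γ t) (speedF (Φ.γ t)) x = 0 ∧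
    kds (Φ.γ t) 5 x + curv (Φ.γ t) x * kds (Φ.γ t) 1 x * kds (Φ.γ t) 2 x
      + (curv (Φ.γ t) x) ^ 2 * kds (Φ.γ t) 3 x - (1 / 2) * (kds (Φ.γ t) 1 x) ^ 3 = 0 := by
  have hxI : x ∈ Icc (-1 : ℝ) 1 := by rcases hx with rfl | rfl <;> norm_num
  have hslice (u : ℝ) : ContDiff ℝ (⊤ : ℕ∞) (Φ.γ u) :=
    Φ.smooth.comp (contDiff_const.prodMk contDiff_id)
  have hreg := Φ.regular ht hxI
  obtain ⟨hFd, hFs⟩ := hasDerivAt_speedF (hslice t).contDiffAt hreg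
  suffices h : deriv (speedF (Φ.γ t)) x = 0 by
    have h0 : aderiv (Φ.γ t) (speedF (Φ.γ t)) x = 0 := by simp [aderiv, h]
    exact ⟨h0, hFs ▸ h0⟩
  have hτ : ∀ u, inTime T u → utangent (Φ.γ u) x 1 = 0 := by
    intro u hu
    have hn : unormal (Φ.γ u) x 0 = 0 := by
      rcases hx with rfl | rfl
      exacts [(B.neumann hu).1, (B.neumann hu).2]
    simpa [unormal, rot_apply_zero] using hn
  obtain ⟨hτd, hτne⟩ := hasDerivAt_utangent_zero (hslice t).contDiffAt hreg (hτ t ht)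
  set g : ℝ × ℝ → ℝ := fun p => Function.uncurry Φ.γ p 1
  have hg : ContDiff ℝ (⊤ : ℕ∞) g := contDiff_euclidean.mp Φ.smooth 1
  have hgd (p : ℝ × ℝ) : HasFDerivAt g (fderiv ℝ g p) p :=
    (hg.differentiable (by simp) p).hasFDerivAt
  have hgx (u y : ℝ) : fderiv ℝ g (u, y) (0, 1) = deriv (Φ.γ u) y 1 := by
    have hp : HasDerivAt (fun y : ℝ => (u, y)) ((0 : ℝ), (1 : ℝ)) y :=
      (hasDerivAt_const y u).prodMk (hasDerivAt_id y)
    exact ((hgd (u, y)).comp_hasDerivAt y hp).unique (hasDerivWithinAt_univ.mp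
      ((hslice u).differentiable (by simp) y).hasDerivAt.hasDerivWithinAt.apply_one)
  have hgt : ∀ y ∈ Icc (-1 : ℝ) 1,
      fderiv ℝ g (t, y) (1, 0) = speedF (Φ.γ t) y * utangent (Φ.γ t) y 0 := by
    intro y hy
    have hp : HasDerivAt (fun u : ℝ => (u, y)) ((1 : ℝ), (0 : ℝ)) t :=
      (hasDerivAt_id t).prodMk (hasDerivAt_const t y)
    have hgu := (hgd (t, y)).comp_hasDerivAt t hp
    have hflow : HasDerivWithinAt (fun u => g (u, y))
        (speedF (Φ.γ t) y * utangent (Φ.γ t) y 0) (Ici 0) t := (Φ.flow ht hy).apply_one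
    exact (uniqueDiffOn_Ici (0 : ℝ) t ht.1).eq_deriv _ hgu.hasDerivWithinAt hflow
  obtain ⟨d, hdt, hdx⟩ := hasDerivAt_fderiv_apply_comm hg t x
  have hgx0 : ∀ u, inTime T u → fderiv ℝ g (u, x) (0, 1) = 0 := by
    intro u hu
    have h := hτ u hu
    rw [hgx]
    simpa [utangent, aderivVec, Φ.regular hu hxI] using h
  have hd0 : d = 0 := by
    have hev : (fun u => fderiv ℝ g (u, x) (0, 1)) =ᶠ[nhdsWithin t (Ici t)] fun _ => 0 :=
      (eventually_inTime ht).mono hgx0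
    exact (uniqueDiffOn_Ici t t self_mem_Ici).eq_deriv _ hdt.hasDerivWithinAt
      ((hasDerivWithinAt_const t _ (0 : ℝ)).congr_of_eventuallyEq hev (hgx0 t ht))
  have hprod := (uniqueDiffOn_Icc (by norm_num : (-1 : ℝ) < 1) x hxI).eq_deriv _
    hdx.hasDerivWithinAt ((hFd.mul hτd).hasDerivWithinAt.congr hgt (hgt x hxI))
  simpa [hd0, hτne] using hprod
end
end

section
/- Under the flow with Neumann boundary conditions and k_s(±1,t) = k_{sss}(±1,t) = 0, every odd-order arc length derivative of curvature vanishes on the boundary: k_{s^{2ℓ+1}}(±1, t) = 0 for every ℓ ∈ ℕ and every t ∈ [0,T). -/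
noncomputable section

open Real Set MeasureTheory intervalIntegral
open scoped ENNReal RealInnerProductSpace

open scoped ContDiff

/-- The derivative of `f` at a point of the time-parameter plane in the direction `v`. -/
def dirDeriv (v : ℝ × ℝ) (f : ℝ × ℝ → ℝ) (p : ℝ × ℝ) : ℝ := fderiv ℝ f p v

/-- The arc length derivative in the time-parameter plane, for the length density `g`. -/
def arcDeriv (g f : ℝ × ℝ → ℝ) (p : ℝ × ℝ) : ℝ := (g p)⁻¹ * dirDeriv (0, 1) f p

section Calculus

variable {U V : Set (ℝ × ℝ)} {f g h : ℝ × ℝ → ℝ} {p v w : ℝ × ℝ}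

lemma ContDiffOn.differentiableAt_of_isOpen (hf : ContDiffOn ℝ ∞ f V) (hV : IsOpen V)
    (hp : p ∈ V) : DifferentiableAt ℝ f p :=
  (hf.contDiffAt (hV.mem_nhds hp)).differentiableAt (by simp)

lemma ContDiffOn.dirDeriv (hf : ContDiffOn ℝ ∞ f V) (hV : IsOpen V) (v : ℝ × ℝ) :
    ContDiffOn ℝ ∞ (dirDeriv v f) V :=
  (hf.fderiv_of_isOpen hV (m := ∞) (by simp)).clm_apply contDiffOn_const

lemma ContDiffOn.arcDeriv (hf : ContDiffOn ℝ ∞ f V) (hg : ContDiffOn ℝ ∞ g V) (hV : IsOpen V)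
    (hg0 : ∀ p ∈ V, g p ≠ 0) : ContDiffOn ℝ ∞ (arcDeriv g f) V :=
  (hg.inv hg0).mul (hf.dirDeriv hV _)

lemma dirDeriv_const (c : ℝ) : dirDeriv v (fun _ => c) p = 0 := by
  simp [dirDeriv]

lemma dirDeriv_add (hf : DifferentiableAt ℝ f p) (hg : DifferentiableAt ℝ g p) :
    dirDeriv v (fun q => f q + g q) p = dirDeriv v f p + dirDeriv v g p := by
  simp [dirDeriv, fderiv_fun_add hf hg]

lemma dirDeriv_neg : dirDeriv v (fun q => -f q) p = -dirDeriv v f p := by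
  simp [dirDeriv, fderiv_fun_neg]

lemma dirDeriv_mul (hf : DifferentiableAt ℝ f p) (hg : DifferentiableAt ℝ g p) :
    dirDeriv v (fun q => f q * g q) p = f p * dirDeriv v g p + g p * dirDeriv v f p := by
  simp [dirDeriv, fderiv_fun_mul hf hg]

lemma dirDeriv_inv (hf : DifferentiableAt ℝ f p) (h0 : f p ≠ 0) :
    dirDeriv v (fun q => (f q)⁻¹) p = -(dirDeriv v f p / f p ^ 2) := by
  have h := dirDeriv_mul (v := v) hf (hf.fun_inv h0)
  have he : (fun q => f q * (f q)⁻¹) =ᶠ[nhds p] fun _ => (1 : ℝ) := by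
    filter_upwards [hf.continuousAt.eventually_ne h0] with q hq
    exact mul_inv_cancel₀ hq
  have h1 : dirDeriv v (fun q => f q * (f q)⁻¹) p = 0 := by
    simp [dirDeriv, he.fderiv_eq]
  rw [h1] at h
  field_simp at h ⊢
  linarith

lemma dirDeriv_congr (hU : IsOpen U) (h : EqOn f g U) (hp : p ∈ U) :
    dirDeriv v f p = dirDeriv v g p := by
  rw [dirDeriv, dirDeriv, (h.eventuallyEq_of_mem (hU.mem_nhds hp)).fderiv_eq]

lemma arcDeriv_congr (hU : IsOpen U) (he : EqOn f h U) (hp : p ∈ U) :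
    arcDeriv g f p = arcDeriv g h p := by
  rw [arcDeriv, arcDeriv, dirDeriv_congr hU he hp]

lemma arcDeriv_const (c : ℝ) : arcDeriv g (fun _ => c) p = 0 := by
  rw [arcDeriv, dirDeriv_const, mul_zero]

lemma arcDeriv_add (hf : DifferentiableAt ℝ f p) (hh : DifferentiableAt ℝ h p) :
    arcDeriv g (fun q => f q + h q) p = arcDeriv g f p + arcDeriv g h p := by
  rw [arcDeriv, dirDeriv_add hf hh, mul_add]; rfl

lemma arcDeriv_mul (hf : DifferentiableAt ℝ f p) (hh : DifferentiableAt ℝ h p) :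
    arcDeriv g (fun q => f q * h q) p = f p * arcDeriv g h p + h p * arcDeriv g f p := by
  rw [arcDeriv, dirDeriv_mul hf hh, arcDeriv, arcDeriv]; ring

lemma arcDeriv_neg : arcDeriv g (fun q => -f q) p = -arcDeriv g f p := by
  rw [arcDeriv, dirDeriv_neg, arcDeriv]; ring

lemma dirDeriv_comm (hf : ContDiffOn ℝ ∞ f V) (hV : IsOpen V) (hp : p ∈ V) :
    dirDeriv v (dirDeriv w f) p = dirDeriv w (dirDeriv v f) p := by
  have hd : DifferentiableAt ℝ (fderiv ℝ f) p :=
    ((hf.fderiv_of_isOpen hV (m := ∞) (by simp)).contDiffAt (hV.mem_nhds hp)).differentiableAt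
      (by simp)
  have key (v w : ℝ × ℝ) : dirDeriv v (dirDeriv w f) p = fderiv ℝ (fderiv ℝ f) p v w := by
    change fderiv ℝ (fun q => fderiv ℝ f q w) p v = _
    rw [fderiv_clm_apply hd (differentiableAt_const w)]
    simp
  rw [key, key]
  exact (hf.contDiffAt (hV.mem_nhds hp)).isSymmSndFDerivAt
    (by simpa using WithTop.coe_le_coe.2 (le_top : (2 : ℕ∞) ≤ ⊤)) v w

lemma deriv_snd_slice (hf : DifferentiableAt ℝ f p) :
    deriv (fun y => f (p.1, y)) p.2 = dirDeriv (0, 1) f p := by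
  have h1 : HasDerivAt (fun y : ℝ => (p.1, y)) ((0, 1) : ℝ × ℝ) p.2 :=
    (hasDerivAt_const _ _).prodMk (hasDerivAt_id _)
  exact (hf.hasFDerivAt.comp_hasDerivAt p.2 h1).deriv

lemma hasDerivAt_fst_slice (hf : DifferentiableAt ℝ f p) :
    HasDerivAt (fun u => f (u, p.2)) (dirDeriv (1, 0) f p) p.1 := by
  have h1 : HasDerivAt (fun u : ℝ => (u, p.2)) ((1, 0) : ℝ × ℝ) p.1 :=
    (hasDerivAt_id _).prodMk (hasDerivAt_const _ _)
  exact hf.hasFDerivAt.comp_hasDerivAt p.1 h1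

/-- Commutator of the time derivative with the arc length derivative, when the length density
evolves by `∂ₜ g = -c g`. -/
lemma dirDeriv_arcDeriv {c : ℝ} (hf : ContDiffOn ℝ ∞ f V) (hg : ContDiffOn ℝ ∞ g V)
    (hV : IsOpen V) (hp : p ∈ V) (hg0 : g p ≠ 0) (hgt : dirDeriv v g p = -(c * g p)) :
    dirDeriv v (arcDeriv g f) p = arcDeriv g (dirDeriv v f) p + c * arcDeriv g f p := by
  have hgd := hg.differentiableAt_of_isOpen hV hp
  have h := dirDeriv_mul (v := v) (hgd.fun_inv hg0)
    ((hf.dirDeriv hV (0, 1)).differentiableAt_of_isOpen hV hp)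
  rw [dirDeriv_inv hgd hg0, hgt, dirDeriv_comm hf hV hp] at h
  refine h.trans ?_
  rw [arcDeriv, arcDeriv]
  field_simp

end Calculus

/-- Differential polynomials in the functions `K i`, `i < n`, up to equality on `V`, all of whose
monomials have derivative count of parity `r`. -/
inductive DiffPoly (V : Set (ℝ × ℝ)) (K : ℕ → ℝ × ℝ → ℝ) (n : ℕ) :
    ZMod 2 → (ℝ × ℝ → ℝ) → Prop
  | const (c : ℝ) : DiffPoly V K n 0 (fun _ => c)
  | var {i : ℕ} (hi : i < n) : DiffPoly V K n i (K i)
  | add {r : ZMod 2} {f g : ℝ × ℝ → ℝ} : DiffPoly V K n r f → DiffPoly V K n r g →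
      DiffPoly V K n r (fun p => f p + g p)
  | mul {r s : ZMod 2} {f g : ℝ × ℝ → ℝ} : DiffPoly V K n r f → DiffPoly V K n s g →
      DiffPoly V K n (r + s) (fun p => f p * g p)
  | zero (r : ZMod 2) : DiffPoly V K n r (fun _ => 0)
  | congr {r : ZMod 2} {f g : ℝ × ℝ → ℝ} : DiffPoly V K n r f → EqOn g f V →
      DiffPoly V K n r g

namespace DiffPoly

variable {V : Set (ℝ × ℝ)} {K : ℕ → ℝ × ℝ → ℝ} {n m : ℕ} {r : ZMod 2} {f g : ℝ × ℝ → ℝ}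
  {p : ℝ × ℝ}

lemma mono (h : DiffPoly V K n r f) (hnm : n ≤ m) : DiffPoly V K m r f := by
  induction h with
  | const c => exact const c
  | var hi => exact var (hi.trans_le hnm)
  | add _ _ h1 h2 => exact add h1 h2
  | mul _ _ h1 h2 => exact mul h1 h2
  | zero r => exact zero r
  | congr _ he h => exact congr h he

lemma contDiffOn (h : DiffPoly V K n r f) (hK : ∀ i, ContDiffOn ℝ ∞ (K i) V) :
    ContDiffOn ℝ ∞ f V := by
  induction h with
  | const c => exact contDiffOn_const
  | var hi => exact hK _
  | add _ _ h1 h2 => exact h1.add h2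
  | mul _ _ h1 h2 => exact h1.mul h2
  | zero r => exact contDiffOn_const
  | congr _ he h => exact h.congr he

lemma eq_zero (h : DiffPoly V K n r f) (hr : r = 1) (hp : p ∈ V)
    (h0 : ∀ i < n, Odd i → K i p = 0) : f p = 0 := by
  induction h with
  | const c => exact absurd hr (by decide)
  | var hi => exact h0 _ hi (ZMod.natCast_eq_one_iff_odd.1 hr)
  | add _ _ h1 h2 => simp [h1 hr, h2 hr]
  | @mul a b _ _ _ _ h1 h2 =>
    have hab : ∀ a b : ZMod 2, a + b = 1 → a = 1 ∨ b = 1 := by decide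
    rcases hab a b hr with h | h
    · simp [h1 h]
    · simp [h2 h]
  | zero r => rfl
  | congr _ he h => rw [he hp, h hr]

lemma arcDeriv (h : DiffPoly V K n r f) (hV : IsOpen V)
    (hK : ∀ i, ContDiffOn ℝ ∞ (K i) V) (hs : ∀ i, EqOn (K (i + 1)) (arcDeriv g (K i)) V) :
    DiffPoly V K (n + 1) (r + 1) (arcDeriv g f) := by
  induction h with
  | const c => exact (zero _).congr fun p _ => arcDeriv_const c
  | @var i hi =>
    have h := (var (V := V) (K := K) (Nat.succ_lt_succ hi)).congr (hs i).symm
    rwa [Nat.cast_succ] at h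
  | add d1 d2 h1 h2 =>
    exact (add h1 h2).congr fun p hp => arcDeriv_add
      ((d1.contDiffOn hK).differentiableAt_of_isOpen hV hp)
      ((d2.contDiffOn hK).differentiableAt_of_isOpen hV hp)
  | @mul a b f1 f2 d1 d2 h1 h2 =>
    have e1 := mul (d1.mono n.le_succ) h2
    have e2 := mul (d2.mono n.le_succ) h1
    rw [show b + (a + 1) = a + b + 1 by ring] at e2
    rw [← add_assoc] at e1
    exact (add e1 e2).congr fun p hp => arcDeriv_mul
      ((d1.contDiffOn hK).differentiableAt_of_isOpen hV hp)
      ((d2.contDiffOn hK).differentiableAt_of_isOpen hV hp)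
  | zero r => exact (zero _).congr fun p _ => arcDeriv_const 0
  | congr _ he h => exact h.congr fun p hp => arcDeriv_congr hV he hp

end DiffPoly

namespace SixthFlow

variable {T : ℝ≥0∞} (Φ : SixthFlow T)

/-- The set of all `(t, x)` at which the curve is regular. -/
def regularSet : Set (ℝ × ℝ) := {p | deriv (Φ.γ p.1) p.2 ≠ 0}

/-- The length density `|∂ₓγ|`. -/
def density (p : ℝ × ℝ) : ℝ := ‖deriv (Φ.γ p.1) p.2‖

/-- The coordinates of the curve. -/
def coord (i : Fin 2) (p : ℝ × ℝ) : ℝ := Φ.γ p.1 p.2 i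

/-- The coordinates of the unit tangent. -/
def tangent (i : Fin 2) (p : ℝ × ℝ) : ℝ := utangent (Φ.γ p.1) p.2 i

/-- The derivative `k_{s^j}` as a function of time and parameter. -/
def curvDeriv (j : ℕ) (p : ℝ × ℝ) : ℝ := kds (Φ.γ p.1) j p.2

/-- The normal speed as a function of time and parameter. -/
def speed (p : ℝ × ℝ) : ℝ := speedF (Φ.γ p.1) p.2

/-- The space-time domain `[0, T) × [-1, 1]` of the flow. -/
def domain (_ : SixthFlow T) : Set (ℝ × ℝ) := {t | inTime T t} ×ˢ Icc (-1) 1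

/-- The open space-time domain `(0, T) × (-1, 1)`. -/
def openDomain (_ : SixthFlow T) : Set (ℝ × ℝ) :=
  {t | 0 < t ∧ ENNReal.ofReal t < T} ×ˢ Ioo (-1) 1

lemma isOpen_openDomain : IsOpen Φ.openDomain :=
  (isOpen_Ioi.inter (isOpen_Iio.preimage ENNReal.continuous_ofReal)).prod isOpen_Ioo

lemma openDomain_subset_domain : Φ.openDomain ⊆ Φ.domain :=
  fun _ hp => ⟨⟨hp.1.1.le, hp.1.2⟩, Ioo_subset_Icc_self hp.2⟩

lemma domain_subset_closure : Φ.domain ⊆ closure Φ.openDomain := by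
  rintro ⟨t, x⟩ ⟨ht, hx⟩
  rw [openDomain, closure_prod_eq, closure_Ioo (by norm_num)]
  refine ⟨?_, hx⟩
  have hU : IsOpen {u : ℝ | ENNReal.ofReal u < T} :=
    isOpen_Iio.preimage ENNReal.continuous_ofReal
  have h := hU.closure_inter (s := Ioi 0)
  have h1 : t ∈ closure (Ioi (0 : ℝ)) := by
    rw [closure_Ioi]; exact ht.1
  exact closure_mono (fun u hu => hu) (h ⟨h1, ht.2⟩)

lemma domain_subset_regularSet : Φ.domain ⊆ Φ.regularSet :=
  fun _ hp => Φ.regular hp.1 hp.2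

lemma openDomain_subset_regularSet : Φ.openDomain ⊆ Φ.regularSet :=
  Φ.openDomain_subset_domain.trans Φ.domain_subset_regularSet

lemma hasDerivAt_curve (p : ℝ × ℝ) :
    HasDerivAt (Φ.γ p.1) (fderiv ℝ (Function.uncurry Φ.γ) p (0, 1)) p.2 := by
  have h1 : HasDerivAt (fun y : ℝ => (p.1, y)) ((0, 1) : ℝ × ℝ) p.2 :=
    (hasDerivAt_const _ _).prodMk (hasDerivAt_id _)
  exact ((Φ.smooth.differentiable (by simp)) p).hasFDerivAt.comp_hasDerivAt p.2 h1

lemma deriv_curve_eq :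
    (fun p : ℝ × ℝ => deriv (Φ.γ p.1) p.2) =
      fun p => fderiv ℝ (Function.uncurry Φ.γ) p (0, 1) :=
  funext fun p => (Φ.hasDerivAt_curve p).deriv

lemma contDiff_deriv_curve : ContDiff ℝ ∞ fun p : ℝ × ℝ => deriv (Φ.γ p.1) p.2 := by
  rw [deriv_curve_eq]
  exact (Φ.smooth.fderiv_right (m := ∞) (by simp)).clm_apply contDiff_const

lemma isOpen_regularSet : IsOpen Φ.regularSet :=
  isOpen_ne.preimage Φ.contDiff_deriv_curve.continuous

lemma density_ne_zero {p : ℝ × ℝ} (hp : p ∈ Φ.regularSet) : Φ.density p ≠ 0 :=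
  norm_ne_zero_iff.2 hp

lemma contDiffOn_density : ContDiffOn ℝ ∞ Φ.density Φ.regularSet :=
  Φ.contDiff_deriv_curve.contDiffOn.norm ℝ fun _ hp => hp

lemma contDiff_coord (i : Fin 2) : ContDiff ℝ ∞ (Φ.coord i) :=
  contDiff_euclidean.1 Φ.smooth i

lemma _root_.deriv_euclidean_apply {f : ℝ → E2} {x : ℝ} (hf : DifferentiableAt ℝ f x)
    (i : Fin 2) : deriv f x i = deriv (fun y => f y i) x :=
  (((EuclideanSpace.proj i : E2 →L[ℝ] ℝ).hasFDerivAt (x := f x)).comp_hasDerivAt x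
    hf.hasDerivAt).deriv.symm

lemma deriv_curve_apply (i : Fin 2) (p : ℝ × ℝ) :
    deriv (Φ.γ p.1) p.2 i = dirDeriv (0, 1) (Φ.coord i) p :=
  (deriv_euclidean_apply (Φ.hasDerivAt_curve p).differentiableAt i).trans
    (deriv_snd_slice ((Φ.contDiff_coord i).differentiable (by simp) p))

lemma tangent_eq (i : Fin 2) : Φ.tangent i = arcDeriv Φ.density (Φ.coord i) := by
  funext p
  rw [arcDeriv, ← deriv_curve_apply]
  rfl

lemma contDiffOn_tangent (i : Fin 2) : ContDiffOn ℝ ∞ (Φ.tangent i) Φ.regularSet := by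
  rw [tangent_eq]
  exact (Φ.contDiff_coord i).contDiffOn.arcDeriv Φ.contDiffOn_density Φ.isOpen_regularSet
    fun _ => Φ.density_ne_zero

lemma tangent_sq {p : ℝ × ℝ} (hp : p ∈ Φ.regularSet) :
    Φ.tangent 0 p * Φ.tangent 0 p + Φ.tangent 1 p * Φ.tangent 1 p = 1 := by
  have h : ‖utangent (Φ.γ p.1) p.2‖ = 1 := by
    rw [utangent, aderivVec, norm_smul, norm_inv, norm_norm]
    exact inv_mul_cancel₀ (Φ.density_ne_zero hp)
  have h2 := EuclideanSpace.real_norm_sq_eq (utangent (Φ.γ p.1) p.2)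
  rw [h, Fin.sum_univ_two] at h2
  simp only [tangent]
  linarith

lemma arcDeriv_eq_aderiv {f : ℝ × ℝ → ℝ} {p : ℝ × ℝ} (hf : DifferentiableAt ℝ f p) :
    aderiv (Φ.γ p.1) (fun y => f (p.1, y)) p.2 = arcDeriv Φ.density f p := by
  rw [aderiv, deriv_snd_slice hf]; rfl

lemma deriv_utangent_apply (i : Fin 2) {p : ℝ × ℝ} (hp : p ∈ Φ.regularSet) :
    aderivVec (Φ.γ p.1) (utangent (Φ.γ p.1)) p.2 i = arcDeriv Φ.density (Φ.tangent i) p := by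
  have hd (j : Fin 2) : DifferentiableAt ℝ (Φ.tangent j) p :=
    (Φ.contDiffOn_tangent j).differentiableAt_of_isOpen Φ.isOpen_regularSet hp
  have hs : DifferentiableAt ℝ (fun y : ℝ => (p.1, y)) p.2 := by fun_prop
  have hu : DifferentiableAt ℝ (utangent (Φ.γ p.1)) p.2 :=
    differentiableAt_euclidean.2 fun j => (hd j).comp (f := fun y : ℝ => (p.1, y)) p.2 hs
  rw [← Φ.arcDeriv_eq_aderiv (hd i), aderiv]
  exact congrArg _ (deriv_euclidean_apply hu i)

lemma unormal_apply_zero (p : ℝ × ℝ) : unormal (Φ.γ p.1) p.2 0 = -Φ.tangent 1 p := by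
  simp [unormal, rot, tangent]

lemma unormal_apply_one (p : ℝ × ℝ) : unormal (Φ.γ p.1) p.2 1 = Φ.tangent 0 p := by
  simp [unormal, rot, tangent]

lemma curvDeriv_zero {p : ℝ × ℝ} (hp : p ∈ Φ.regularSet) :
    Φ.curvDeriv 0 p = Φ.tangent 0 p * arcDeriv Φ.density (Φ.tangent 1) p +
      -(Φ.tangent 1 p * arcDeriv Φ.density (Φ.tangent 0) p) := by
  change curv (Φ.γ p.1) p.2 = _
  rw [curv, PiLp.inner_apply, Fin.sum_univ_two, unormal_apply_zero, unormal_apply_one,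
    Φ.deriv_utangent_apply 0 hp, Φ.deriv_utangent_apply 1 hp]
  simp only [RCLike.inner_apply, conj_trivial]
  ring

lemma contDiffOn_arcDeriv {f : ℝ × ℝ → ℝ} (hf : ContDiffOn ℝ ∞ f Φ.regularSet) :
    ContDiffOn ℝ ∞ (arcDeriv Φ.density f) Φ.regularSet :=
  hf.arcDeriv Φ.contDiffOn_density Φ.isOpen_regularSet fun _ => Φ.density_ne_zero

lemma contDiffOn_curvDeriv (j : ℕ) : ContDiffOn ℝ ∞ (Φ.curvDeriv j) Φ.regularSet := by
  induction j with
  | zero =>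
    exact (((Φ.contDiffOn_tangent 0).mul (Φ.contDiffOn_arcDeriv (Φ.contDiffOn_tangent 1))).add
      ((Φ.contDiffOn_tangent 1).mul (Φ.contDiffOn_arcDeriv (Φ.contDiffOn_tangent 0))).neg).congr
      fun p hp => Φ.curvDeriv_zero hp
  | succ j ih =>
    exact (Φ.contDiffOn_arcDeriv ih).congr fun p hp =>
      Φ.arcDeriv_eq_aderiv (ih.differentiableAt_of_isOpen Φ.isOpen_regularSet hp)

lemma curvDeriv_succ (j : ℕ) :
    EqOn (Φ.curvDeriv (j + 1)) (arcDeriv Φ.density (Φ.curvDeriv j)) Φ.regularSet :=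
  fun _ hp => Φ.arcDeriv_eq_aderiv
    ((Φ.contDiffOn_curvDeriv j).differentiableAt_of_isOpen Φ.isOpen_regularSet hp)

/-- Differential polynomials in the curvature. -/
abbrev CurvPoly (n : ℕ) (r : ZMod 2) (f : ℝ × ℝ → ℝ) : Prop :=
  DiffPoly Φ.regularSet Φ.curvDeriv n r f

variable {Φ} in
lemma CurvPoly.arcDeriv {n : ℕ} {r : ZMod 2} {f : ℝ × ℝ → ℝ} (h : Φ.CurvPoly n r f) :
    Φ.CurvPoly (n + 1) (r + 1) (arcDeriv Φ.density f) :=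
  DiffPoly.arcDeriv h Φ.isOpen_regularSet Φ.contDiffOn_curvDeriv Φ.curvDeriv_succ

variable {Φ} in
lemma CurvPoly.contDiffOn {n : ℕ} {r : ZMod 2} {f : ℝ × ℝ → ℝ} (h : Φ.CurvPoly n r f) :
    ContDiffOn ℝ ∞ f Φ.regularSet :=
  DiffPoly.contDiffOn h Φ.contDiffOn_curvDeriv

/-- The normal speed is `k_{s⁴}` plus terms of lower order. -/
lemma exists_speed_eq : ∃ G, Φ.CurvPoly 3 0 G ∧
    Φ.speed = fun p => Φ.curvDeriv 4 p + G p := by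
  have v0 : Φ.CurvPoly 3 0 (Φ.curvDeriv 0) := DiffPoly.var (i := 0) (by norm_num)
  have v1 : Φ.CurvPoly 3 1 (Φ.curvDeriv 1) := by
    simpa using DiffPoly.var (V := Φ.regularSet) (K := Φ.curvDeriv) (n := 3) (i := 1)
      (by norm_num)
  have v2 : Φ.CurvPoly 3 0 (Φ.curvDeriv 2) := DiffPoly.var (i := 2) (by norm_num)
  refine ⟨_, ((v0.mul v0).mul v2).add
    ((DiffPoly.const (-(1 / 2))).mul (v0.mul (v1.mul v1))), funext fun p => ?_⟩
  simp only [speed, speedF, curvDeriv]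
  change _ = _ + (curv (Φ.γ p.1) p.2 * curv (Φ.γ p.1) p.2 * _ +
    _ * (curv (Φ.γ p.1) p.2 * _))
  ring

lemma curvPoly_speed : Φ.CurvPoly 5 0 Φ.speed := by
  obtain ⟨G, hG, h⟩ := Φ.exists_speed_eq
  rw [h]
  exact DiffPoly.add (DiffPoly.var (i := 4) (by norm_num)) (hG.mono (by norm_num))

lemma exists_arcDeriv_speed_eq : ∃ G, Φ.CurvPoly 4 1 G ∧
    EqOn (arcDeriv Φ.density Φ.speed) (fun p => Φ.curvDeriv 5 p + G p) Φ.regularSet := by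
  obtain ⟨G, hG, h⟩ := Φ.exists_speed_eq
  refine ⟨_, hG.arcDeriv, fun p hp => ?_⟩
  rw [h, arcDeriv_add
    ((Φ.contDiffOn_curvDeriv 4).differentiableAt_of_isOpen Φ.isOpen_regularSet hp)
    ((CurvPoly.contDiffOn hG).differentiableAt_of_isOpen Φ.isOpen_regularSet hp),
    ← Φ.curvDeriv_succ 4 hp]

variable {Φ} in
lemma differentiableAt_of_contDiffOn {f : ℝ × ℝ → ℝ} {p : ℝ × ℝ}
    (hf : ContDiffOn ℝ ∞ f Φ.regularSet) (hp : p ∈ Φ.openDomain) : DifferentiableAt ℝ f p :=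
  hf.differentiableAt_of_isOpen Φ.isOpen_regularSet (Φ.openDomain_subset_regularSet hp)

variable {Φ} in
/-- An identity between smooth functions on the open domain extends to the closed domain. -/
lemma eqOn_domain {f h : ℝ × ℝ → ℝ} (hf : ContDiffOn ℝ ∞ f Φ.regularSet)
    (hh : ContDiffOn ℝ ∞ h Φ.regularSet) (he : EqOn f h Φ.openDomain) : EqOn f h Φ.domain :=
  he.of_subset_closure (hf.continuousOn.mono Φ.domain_subset_regularSet)
    (hh.continuousOn.mono Φ.domain_subset_regularSet) Φ.openDomain_subset_domain
    Φ.domain_subset_closure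

lemma dirDeriv_time_coord (i : Fin 2) {p : ℝ × ℝ} (hp : p ∈ Φ.openDomain) :
    dirDeriv (1, 0) (Φ.coord i) p = Φ.speed p * unormal (Φ.γ p.1) p.2 i := by
  have h1 := hasDerivAt_fst_slice ((Φ.contDiff_coord i).differentiable (by simp) p)
  have h2 := (Φ.flow (Φ.openDomain_subset_domain hp).1
    (Φ.openDomain_subset_domain hp).2).hasDerivAt (Ici_mem_nhds hp.1.1)
  have h3 := ((EuclideanSpace.proj i : E2 →L[ℝ] ℝ).hasFDerivAt
    (x := Φ.γ p.1 p.2)).comp_hasDerivAt p.1 h2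
  exact h1.unique h3

lemma frenet {p : ℝ × ℝ} (hp : p ∈ Φ.regularSet) :
    arcDeriv Φ.density (Φ.tangent 0) p = -(Φ.curvDeriv 0 p * Φ.tangent 1 p) ∧
      arcDeriv Φ.density (Φ.tangent 1) p = Φ.curvDeriv 0 p * Φ.tangent 0 p := by
  have hd (j : Fin 2) : DifferentiableAt ℝ (Φ.tangent j) p :=
    (Φ.contDiffOn_tangent j).differentiableAt_of_isOpen Φ.isOpen_regularSet hp
  have h := arcDeriv_congr (g := Φ.density) Φ.isOpen_regularSet
    (fun q hq => Φ.tangent_sq hq) hp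
  rw [arcDeriv_add ((hd 0).fun_mul (hd 0)) ((hd 1).fun_mul (hd 1)), arcDeriv_mul (hd 0) (hd 0),
    arcDeriv_mul (hd 1) (hd 1), arcDeriv_const] at h
  have h1 := Φ.tangent_sq hp
  rw [Φ.curvDeriv_zero hp]
  generalize arcDeriv Φ.density (Φ.tangent 0) p = a' at *
  generalize arcDeriv Φ.density (Φ.tangent 1) p = b' at *
  generalize Φ.tangent 0 p = a at *
  generalize Φ.tangent 1 p = b at *
  constructor
  · linear_combination (-a') * h1 + a / 2 * h
  · linear_combination (-b') * h1 + b / 2 * h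

/-- Evolution of the length density and of the unit tangent. -/
lemma evolution_density_tangent {p : ℝ × ℝ} (hp : p ∈ Φ.openDomain) :
    dirDeriv (1, 0) Φ.density p = -(Φ.curvDeriv 0 p * Φ.speed p * Φ.density p) ∧
      dirDeriv (1, 0) (Φ.tangent 0) p =
        -(arcDeriv Φ.density Φ.speed p * Φ.tangent 1 p) ∧
      dirDeriv (1, 0) (Φ.tangent 1) p = arcDeriv Φ.density Φ.speed p * Φ.tangent 0 p := by
  have hpV := Φ.openDomain_subset_regularSet hp
  have hg0 := Φ.density_ne_zero hpV
  have hd (j : Fin 2) := differentiableAt_of_contDiffOn (Φ.contDiffOn_tangent j) hp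
  have hF := differentiableAt_of_contDiffOn (CurvPoly.contDiffOn Φ.curvPoly_speed) hp
  have hsq := Φ.tangent_sq hpV
  have hsq' := dirDeriv_congr (v := (1, 0)) Φ.isOpen_regularSet
    (fun q hq => Φ.tangent_sq hq) hpV
  rw [dirDeriv_add ((hd 0).fun_mul (hd 0)) ((hd 1).fun_mul (hd 1)), dirDeriv_mul (hd 0) (hd 0),
    dirDeriv_mul (hd 1) (hd 1), dirDeriv_const] at hsq'
  have hev (i : Fin 2) : Φ.density p * dirDeriv (1, 0) (Φ.tangent i) p +
      Φ.tangent i p * dirDeriv (1, 0) Φ.density p =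
      Φ.density p * arcDeriv Φ.density (dirDeriv (1, 0) (Φ.coord i)) p := by
    have h1 : EqOn (fun q => Φ.density q * Φ.tangent i q) (dirDeriv (0, 1) (Φ.coord i))
        Φ.regularSet := fun q hq => by
      change Φ.density q * Φ.tangent i q = _
      rw [tangent_eq]
      exact mul_inv_cancel_left₀ (Φ.density_ne_zero hq) _
    rw [← dirDeriv_mul (differentiableAt_of_contDiffOn Φ.contDiffOn_density hp) (hd i),
      dirDeriv_congr Φ.isOpen_regularSet h1 hpV,
      dirDeriv_comm (Φ.contDiff_coord i).contDiffOn isOpen_univ (mem_univ p), arcDeriv,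
      mul_inv_cancel_left₀ hg0]
  have e0 := hev 0
  have e1 := hev 1
  rw [arcDeriv_congr (h := fun q => -(Φ.speed q * Φ.tangent 1 q)) Φ.isOpen_openDomain
    (fun q hq => by rw [Φ.dirDeriv_time_coord 0 hq, unormal_apply_zero, mul_neg]) hp,
    arcDeriv_neg, arcDeriv_mul hF (hd 1), (Φ.frenet hpV).2] at e0
  rw [arcDeriv_congr (h := fun q => Φ.speed q * Φ.tangent 0 q) Φ.isOpen_openDomain
    (fun q hq => by rw [Φ.dirDeriv_time_coord 1 hq, unormal_apply_one]) hp,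
    arcDeriv_mul hF (hd 0), (Φ.frenet hpV).1] at e1
  generalize arcDeriv Φ.density Φ.speed p = F' at *
  generalize dirDeriv (1, 0) (Φ.tangent 0) p = a' at *
  generalize dirDeriv (1, 0) (Φ.tangent 1) p = b' at *
  generalize dirDeriv (1, 0) Φ.density p = g' at *
  generalize Φ.tangent 0 p = a at *
  generalize Φ.tangent 1 p = b at *
  generalize Φ.density p = g at *
  generalize Φ.curvDeriv 0 p = k at *
  generalize Φ.speed p = F at *
  have hg' : g' = -(k * F * g) := by
    linear_combination a * e0 + b * e1 - g / 2 * hsq' - (g' + k * F * g) * hsq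
  subst hg'
  refine ⟨rfl, mul_left_cancel₀ hg0 ?_, mul_left_cancel₀ hg0 ?_⟩
  · linear_combination e0
  · linear_combination e1

/-- Commutator of the time derivative and the arc length derivative. -/
lemma dirDeriv_time_arcDeriv {f : ℝ × ℝ → ℝ} (hf : ContDiffOn ℝ ∞ f Φ.regularSet) {p : ℝ × ℝ}
    (hp : p ∈ Φ.openDomain) :
    dirDeriv (1, 0) (arcDeriv Φ.density f) p = arcDeriv Φ.density (dirDeriv (1, 0) f) p +
      Φ.curvDeriv 0 p * Φ.speed p * arcDeriv Φ.density f p :=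
  dirDeriv_arcDeriv hf Φ.contDiffOn_density Φ.isOpen_regularSet
    (Φ.openDomain_subset_regularSet hp) (Φ.density_ne_zero (Φ.openDomain_subset_regularSet hp))
    (Φ.evolution_density_tangent hp).1

/-- Evolution of the curvature: `∂ₜ k = F_{ss} + k² F`. -/
lemma evolution_curv {p : ℝ × ℝ} (hp : p ∈ Φ.openDomain) :
    dirDeriv (1, 0) (Φ.curvDeriv 0) p =
      arcDeriv Φ.density (arcDeriv Φ.density Φ.speed) p +
        Φ.curvDeriv 0 p * Φ.curvDeriv 0 p * Φ.speed p := by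
  have hpV := Φ.openDomain_subset_regularSet hp
  have hd (j : Fin 2) := differentiableAt_of_contDiffOn (Φ.contDiffOn_tangent j) hp
  have hda (j : Fin 2) := differentiableAt_of_contDiffOn
    (Φ.contDiffOn_arcDeriv (Φ.contDiffOn_tangent j)) hp
  have hF' := differentiableAt_of_contDiffOn
    (Φ.contDiffOn_arcDeriv (CurvPoly.contDiffOn Φ.curvPoly_speed)) hp
  have hsq := Φ.tangent_sq hpV
  obtain ⟨fr0, fr1⟩ := Φ.frenet hpV
  obtain ⟨-, ev0, ev1⟩ := Φ.evolution_density_tangent hp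
  rw [dirDeriv_congr Φ.isOpen_regularSet (fun q hq => Φ.curvDeriv_zero hq) hpV,
    dirDeriv_add ((hd 0).fun_mul (hda 1)) ((hd 1).fun_mul (hda 0)).fun_neg, dirDeriv_neg,
    dirDeriv_mul (hd 0) (hda 1), dirDeriv_mul (hd 1) (hda 0),
    Φ.dirDeriv_time_arcDeriv (Φ.contDiffOn_tangent 0) hp,
    Φ.dirDeriv_time_arcDeriv (Φ.contDiffOn_tangent 1) hp,
    arcDeriv_congr Φ.isOpen_openDomain
      (fun q hq => (Φ.evolution_density_tangent hq).2.1) hp,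
    arcDeriv_congr Φ.isOpen_openDomain
      (fun q hq => (Φ.evolution_density_tangent hq).2.2) hp,
    arcDeriv_neg, arcDeriv_mul hF' (hd 0), arcDeriv_mul hF' (hd 1), fr0, fr1, ev0, ev1]
  linear_combination (arcDeriv Φ.density (arcDeriv Φ.density Φ.speed) p +
    Φ.curvDeriv 0 p * Φ.curvDeriv 0 p * Φ.speed p) * hsq

/-- Evolution of `k_{s^j}`: the time derivative is `k_{s^{j+6}}` plus terms of lower order, with
the parity of the number of derivatives preserved. -/
lemma exists_evolution_curvDeriv (j : ℕ) : ∃ Q, Φ.CurvPoly (j + 6) j Q ∧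
    EqOn (dirDeriv (1, 0) (Φ.curvDeriv j)) (fun p => Φ.curvDeriv (j + 6) p + Q p)
      Φ.openDomain := by
  have v0 (n : ℕ) : Φ.CurvPoly (n + 1) 0 (Φ.curvDeriv 0) := DiffPoly.var (i := 0) n.succ_pos
  induction j with
  | zero =>
    obtain ⟨G, hG, h⟩ := Φ.exists_arcDeriv_speed_eq
    have h5 := ((v0 5).mul (v0 5)).mul (Φ.curvPoly_speed.mono (m := 6) (by norm_num))
    refine ⟨_, (hG.arcDeriv.mono (m := 6) (by norm_num)).add h5, fun p hp => ?_⟩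
    have hpV := Φ.openDomain_subset_regularSet hp
    rw [Φ.evolution_curv hp, arcDeriv_congr Φ.isOpen_regularSet h hpV,
      arcDeriv_add (differentiableAt_of_contDiffOn (Φ.contDiffOn_curvDeriv 5) hp)
        (differentiableAt_of_contDiffOn (CurvPoly.contDiffOn hG) hp),
      ← Φ.curvDeriv_succ 5 hpV, add_assoc]
  | succ j ih =>
    obtain ⟨Q, hQ, h⟩ := ih
    have h1 : Φ.CurvPoly (j + 7) (j + 1 : ℕ) (Φ.curvDeriv (j + 1)) :=
      DiffPoly.var (by omega)
    have h2 := ((v0 (j + 6)).mul (Φ.curvPoly_speed.mono (m := j + 7) (by omega))).mul h1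
    have h3 := hQ.arcDeriv
    rw [← Nat.cast_succ] at h3
    rw [add_zero, zero_add] at h2
    refine ⟨_, h3.add h2, fun p hp => ?_⟩
    have hpV := Φ.openDomain_subset_regularSet hp
    rw [dirDeriv_congr Φ.isOpen_regularSet (Φ.curvDeriv_succ j) hpV,
      Φ.dirDeriv_time_arcDeriv (Φ.contDiffOn_curvDeriv j) hp,
      arcDeriv_congr Φ.isOpen_openDomain h hp,
      arcDeriv_add (differentiableAt_of_contDiffOn (Φ.contDiffOn_curvDeriv (j + 6)) hp)
        (differentiableAt_of_contDiffOn (CurvPoly.contDiffOn hQ) hp),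
      ← Φ.curvDeriv_succ j hpV, ← Φ.curvDeriv_succ (j + 6) hpV, add_assoc]

/-- The time derivative of a function that vanishes along `[0, T) × {x}`. -/
lemma dirDeriv_time_eq_zero {f : ℝ × ℝ → ℝ} {t x : ℝ} (hf : DifferentiableAt ℝ f (t, x))
    (ht : inTime T t) (h : ∀ u, inTime T u → f (u, x) = 0) :
    dirDeriv (1, 0) f (t, x) = 0 := by
  have h1 := (hasDerivAt_fst_slice hf).hasDerivWithinAt (s := Ici t)
  have hU : {u : ℝ | ENNReal.ofReal u < T} ∈ nhds t :=
    (isOpen_Iio.preimage ENNReal.continuous_ofReal).mem_nhds ht.2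
  have he : (fun u => f (u, x)) =ᶠ[nhdsWithin t (Ici t)] fun _ => 0 := by
    filter_upwards [self_mem_nhdsWithin, mem_nhdsWithin_of_mem_nhds hU] with u hu hu'
    exact h u ⟨ht.1.trans hu, hu'⟩
  have h2 : HasDerivWithinAt (fun u => f (u, x)) 0 (Ici t) t :=
    (hasDerivWithinAt_const t (Ici t) (0 : ℝ)).congr_of_eventuallyEq he (h t ht)
  exact (uniqueDiffWithinAt_Ici t).eq_deriv _ h1 h2

/-- If `k_{s^j}` vanishes along `[0, T) × {x}` for an odd `j`, and so do all the odd derivatives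
of order less than `j + 6` at time `t`, then `k_{s^{j+6}}` vanishes at `(t, x)`. -/
lemma curvDeriv_add_six_eq_zero {j : ℕ} (hj : Odd j) {t x : ℝ} (hp : (t, x) ∈ Φ.domain)
    (h : ∀ u, inTime T u → Φ.curvDeriv j (u, x) = 0)
    (h0 : ∀ i < j + 6, Odd i → Φ.curvDeriv i (t, x) = 0) : Φ.curvDeriv (j + 6) (t, x) = 0 := by
  have hpV := Φ.domain_subset_regularSet hp
  obtain ⟨Q, hQ, he⟩ := Φ.exists_evolution_curvDeriv j
  have h1 := eqOn_domain ((Φ.contDiffOn_curvDeriv j).dirDeriv Φ.isOpen_regularSet (1, 0))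
    ((Φ.contDiffOn_curvDeriv (j + 6)).add (CurvPoly.contDiffOn hQ)) he hp
  rw [dirDeriv_time_eq_zero ((Φ.contDiffOn_curvDeriv j).differentiableAt_of_isOpen
    Φ.isOpen_regularSet hpV) hp.1 h] at h1
  have h2 : Q (t, x) = 0 := hQ.eq_zero (ZMod.natCast_eq_one_iff_odd.2 hj) hpV h0
  simpa [h2] using h1.symm

/-- If the Neumann condition and `k_s = k_{sss} = 0` hold along `[0, T) × {x}`, then
`k_{s⁵} = 0` there as well. -/
lemma curvDeriv_five_eq_zero {t x : ℝ} (hp : (t, x) ∈ Φ.domain)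
    (hN : ∀ u, inTime T u → Φ.tangent 1 (u, x) = 0) (h1 : Φ.curvDeriv 1 (t, x) = 0)
    (h3 : Φ.curvDeriv 3 (t, x) = 0) : Φ.curvDeriv 5 (t, x) = 0 := by
  have hpV := Φ.domain_subset_regularSet hp
  have e := eqOn_domain ((Φ.contDiffOn_tangent 1).dirDeriv Φ.isOpen_regularSet (1, 0))
    ((Φ.contDiffOn_arcDeriv (CurvPoly.contDiffOn Φ.curvPoly_speed)).mul
      (Φ.contDiffOn_tangent 0)) (fun q hq => (Φ.evolution_density_tangent hq).2.2) hp
  rw [dirDeriv_time_eq_zero ((Φ.contDiffOn_tangent 1).differentiableAt_of_isOpen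
    Φ.isOpen_regularSet hpV) hp.1 hN] at e
  obtain ⟨G, hG, h⟩ := Φ.exists_arcDeriv_speed_eq
  have hG0 : G (t, x) = 0 := hG.eq_zero rfl hpV fun i hi hodd => by
    interval_cases i
    · exact absurd hodd (by decide)
    · exact h1
    · exact absurd hodd (by decide)
    · exact h3
  have ha : Φ.tangent 0 (t, x) ≠ 0 := fun h0 => by
    simpa [h0, hN t hp.1] using Φ.tangent_sq hpV
  have hF := (mul_eq_zero.1 e.symm).resolve_right ha
  rw [h hpV] at hF
  simpa [hG0] using hF

end SixthFlow

/-- **Odd curvature derivatives vanish at the boundary.**  Under the flow with Neumann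
boundary conditions and `k_s(±1,t) = k_{sss}(±1,t) = 0`, one has
`k_{s^{2ℓ+1}}(±1, t) = 0` for every `ℓ ∈ ℕ` and every `t ∈ [0,T)`. -/
theorem odd_derivatives_vanish_on_boundary {T : ℝ≥0∞} (Φ : SixthFlow T) (e : ℝ)
    (B : BC Φ e) {t : ℝ} (ht : inTime T t) {x : ℝ} (hx : x = -1 ∨ x = 1) (ℓ : ℕ) :
    kds (Φ.γ t) (2 * ℓ + 1) x = 0 := by
  have hx' : x ∈ Icc (-1 : ℝ) 1 := by
    rcases hx with rfl | rfl <;> norm_num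
  have hN : ∀ u, inTime T u → Φ.tangent 1 (u, x) = 0 := fun u hu => by
    have h := B.neumann hu
    rw [← neg_eq_zero, ← Φ.unormal_apply_zero]
    rcases hx with rfl | rfl
    exacts [h.1, h.2]
  have h1 : ∀ u, inTime T u → Φ.curvDeriv 1 (u, x) = 0 := fun u hu => by
    rcases hx with rfl | rfl
    exacts [(B.noflux hu).1, (B.noflux hu).2]
  have h3 : ∀ u, inTime T u → Φ.curvDeriv 3 (u, x) = 0 := fun u hu => by
    rcases hx with rfl | rfl
    exacts [(B.noflux3 hu).1, (B.noflux3 hu).2]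
  suffices h : ∀ j, Odd j → ∀ u, inTime T u → Φ.curvDeriv j (u, x) = 0 from
    h _ (odd_two_mul_add_one ℓ) t ht
  intro j
  induction j using Nat.strong_induction_on with
  | _ j ih =>
    intro hj u hu
    rcases lt_or_ge j 7 with h7 | h7
    · interval_cases j
      · exact absurd hj (by decide)
      · exact h1 u hu
      · exact absurd hj (by decide)
      · exact h3 u hu
      · exact absurd hj (by decide)
      · exact Φ.curvDeriv_five_eq_zero ⟨hu, hx'⟩ hN (h1 u hu) (h3 u hu)
      · exact absurd hj (by decide)
    · obtain ⟨i, rfl⟩ := Nat.exists_eq_add_of_le' (show 6 ≤ j by omega)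
      have hi : Odd i := by
        rw [Nat.odd_iff] at hj ⊢; omega
      exact Φ.curvDeriv_add_six_eq_zero hi ⟨hu, hx'⟩ (ih i (by omega) hi)
        fun m hm hodd => ih m hm hodd u hu
end
end

section
/- Under the flow with the stated boundary conditions, the total curvature is conserved: (d/dt) ∫_γ k ds = 0 for all t ∈ [0,T). Consequently the winding number ω(t) = (1/(2π)) ∫_γ k ds satisfies ω(t) = ω(0) for all t, and if ω(0) = 0 then the average curvature k̄(t) = (1/L(t)) ∫_γ k ds is identically zero along the flow. -/
noncomputable section

open Real Set MeasureTheory intervalIntegral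
open scoped ENNReal RealInnerProductSpace

lemma rot_smul (c : ℝ) (v : E2) : rot (c • v) = c • rot v := by
  ext i; fin_cases i <;> simp [rot]

lemma continuous_rot : Continuous rot := by
  refine (PiLp.continuous_toLp 2 _).comp (continuous_pi fun i => ?_)
  fin_cases i <;> simp <;> fun_prop

/-- The rate of rotation in `x` of the tangent direction of `γ`. -/
def angSpeed (γ : ℝ → E2) (x : ℝ) : ℝ :=
  ⟪deriv (deriv γ) x, rot (deriv γ x)⟫ / ‖deriv γ x‖ ^ 2

/-- The Frenet equation for the unit tangent, in the parameter `x`. -/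
lemma hasDerivAt_utangent {γ : ℝ → E2} {x : ℝ} (hγ : DifferentiableAt ℝ (deriv γ) x)
    (hx : deriv γ x ≠ 0) :
    HasDerivAt (utangent γ) (angSpeed γ x • unormal γ x) x := by
  have hr : ‖deriv γ x‖ ≠ 0 := norm_ne_zero_iff.mpr hx
  have hsq := hγ.hasDerivAt.norm_sq
  have hn : HasDerivAt (fun y => ‖deriv γ y‖)
      (⟪deriv γ x, deriv (deriv γ) x⟫ / ‖deriv γ x‖) x := by
    have := hsq.sqrt (pow_ne_zero 2 hr)
    simp only [Real.sqrt_sq (norm_nonneg _)] at this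
    exact this.congr_deriv (by field_simp)
  refine ((hn.inv hr).smul hγ.hasDerivAt).congr_deriv ?_
  have hr2 : ‖deriv γ x‖ ^ 2 = deriv γ x 0 ^ 2 + deriv γ x 1 ^ 2 := by
    simp [EuclideanSpace.norm_sq_eq, Fin.sum_univ_two]
  unfold angSpeed unormal utangent aderivVec
  rw [rot_smul, Pi.inv_apply]
  generalize deriv (deriv γ) x = q at *
  generalize deriv γ x = p at *
  generalize ‖p‖ = r at *
  ext i
  fin_cases i <;>
    simp [PiLp.inner_apply, Fin.sum_univ_two, rot] <;> field_simp
  · linear_combination q 0 * hr2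
  · linear_combination q 1 * hr2

lemma norm_unormal {γ : ℝ → E2} {x : ℝ} (hx : deriv γ x ≠ 0) : ‖unormal γ x‖ = 1 := by
  have hr : ‖deriv γ x‖ ≠ 0 := norm_ne_zero_iff.mpr hx
  have h : ‖rot (deriv γ x)‖ = ‖deriv γ x‖ := by
    simp [EuclideanSpace.norm_eq, Fin.sum_univ_two, rot, add_comm]
  rw [unormal, utangent, aderivVec, rot_smul, norm_smul, h]
  simp [hr]

lemma curv_mul_norm {γ : ℝ → E2} {x : ℝ} (hγ : DifferentiableAt ℝ (deriv γ) x)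
    (hx : deriv γ x ≠ 0) : curv γ x * ‖deriv γ x‖ = angSpeed γ x := by
  have hr : ‖deriv γ x‖ ≠ 0 := norm_ne_zero_iff.mpr hx
  rw [curv, aderivVec, (hasDerivAt_utangent hγ hx).deriv, real_inner_smul_left,
    real_inner_smul_left, real_inner_self_eq_norm_sq, norm_unormal hx]
  field_simp

lemma totalK_eq_integral_angSpeed {γ : ℝ → E2} (hγ : Differentiable ℝ (deriv γ))
    (hreg : ∀ x ∈ Icc (-1 : ℝ) 1, deriv γ x ≠ 0) :
    totalK γ = ∫ x in (-1 : ℝ)..1, angSpeed γ (projIcc (-1) 1 (by norm_num) x) := by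
  refine integral_congr fun x hx => ?_
  rw [uIcc_of_le (by norm_num)] at hx
  simp only [projIcc_of_mem _ hx]
  exact curv_mul_norm (hγ x) (hreg x hx)

/-- If the end tangents of a regular curve are both horizontal, then its total curvature is a
multiple of `π`. -/
lemma sin_totalK_eq_zero {γ : ℝ → E2} (hγ : Differentiable ℝ (deriv γ))
    (hcont : Continuous fun x => angSpeed γ (projIcc (-1 : ℝ) 1 (by norm_num) x))
    (hreg : ∀ x ∈ Icc (-1 : ℝ) 1, deriv γ x ≠ 0)
    (hl : unormal γ (-1) 0 = 0) (hr : unormal γ 1 0 = 0) : sin (totalK γ) = 0 := by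
  rw [totalK_eq_integral_angSpeed hγ hreg]
  set h : ℝ → ℝ := fun x => angSpeed γ (projIcc (-1 : ℝ) 1 (by norm_num) x)
  set Θ : ℝ → ℝ := fun x => ∫ y in (-1 : ℝ)..x, h y
  have hΘ (x : ℝ) : HasDerivAt Θ (h x) x := hcont.integral_hasStrictDerivAt _ _ |>.hasDerivAt
  have hN : ∀ x ∈ Icc (-1 : ℝ) 1, HasDerivAt
      (fun y => utangent γ y 1 * cos (Θ y) - utangent γ y 0 * sin (Θ y)) 0 x := by
    intro x hx
    have hτ := hasDerivAt_utangent (hγ x) (hreg x hx)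
    have h0 := (EuclideanSpace.proj (𝕜 := ℝ) (0 : Fin 2)).hasFDerivAt.comp_hasDerivAt x hτ
    have h1 := (EuclideanSpace.proj (𝕜 := ℝ) (1 : Fin 2)).hasFDerivAt.comp_hasDerivAt x hτ
    refine ((h1.mul (hΘ x).cos).sub (h0.mul (hΘ x).sin)).congr_deriv ?_
    simp only [h, projIcc_of_mem _ hx]
    simp [unormal, rot]
    ring
  have hconst := constant_of_has_deriv_right_zero
    (fun x hx => (hN x hx).continuousAt.continuousWithinAt)
    (fun x hx => (hN x (Ico_subset_Icc_self hx)).hasDerivWithinAt) 1 (by simp)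
  have hl' : utangent γ (-1) 1 = 0 := by simpa [unormal, rot] using hl
  have hr' : utangent γ 1 1 = 0 := by simpa [unormal, rot] using hr
  have hne : utangent γ 1 0 ≠ 0 := by
    intro h0
    have := norm_unormal (hreg 1 (by simp))
    simp [unormal, rot, EuclideanSpace.norm_eq, Fin.sum_univ_two, h0, hr'] at this
  simpa [hl', hr', hne, Θ] using hconst

lemma contDiff_uncurry_deriv {E : Type*} [NormedAddCommGroup E] [NormedSpace ℝ E]
    {f : ℝ → ℝ → E} (hf : ContDiff ℝ (⊤ : ℕ∞) (Function.uncurry f)) :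
    ContDiff ℝ (⊤ : ℕ∞) (Function.uncurry fun t => deriv (f t)) := by
  have h : (Function.uncurry fun t => deriv (f t)) =
      fun p => fderiv ℝ (Function.uncurry f) p (0, 1) := by
    ext1 ⟨t, x⟩
    have hd : HasFDerivAt (Function.uncurry f) _ (t, x) :=
      (hf.differentiable (by simp) (t, x)).hasFDerivAt
    exact (hd.comp_hasDerivAt x ((hasDerivAt_const x t).prodMk (hasDerivAt_id x))).deriv
  rw [h]
  exact (hf.fderiv_right (m := (⊤ : ℕ∞)) (by simp)).clm_apply contDiff_const

lemma SixthFlow.differentiable_deriv {T : ℝ≥0∞} (Φ : SixthFlow T) (t : ℝ) :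
    Differentiable ℝ (deriv (Φ.γ t)) :=
  ((contDiff_uncurry_deriv Φ.smooth).comp (contDiff_prodMk_right t)).differentiable (by simp)

lemma SixthFlow.continuous_angSpeed {T : ℝ≥0∞} (Φ : SixthFlow T) :
    Continuous (Function.uncurry fun (t : {t // inTime T t}) (x : ℝ) =>
      angSpeed (Φ.γ t) (projIcc (-1 : ℝ) 1 (by norm_num) x)) := by
  have h1 := contDiff_uncurry_deriv Φ.smooth
  have h2 := contDiff_uncurry_deriv h1
  have hp : Continuous fun p : {t // inTime T t} × ℝ =>
      ((p.1 : ℝ), (projIcc (-1 : ℝ) 1 (by norm_num) p.2 : ℝ)) := by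
    have := continuous_projIcc (a := (-1 : ℝ)) (b := 1) (h := by norm_num)
    fun_prop
  have c1 := h1.continuous.comp hp
  have c2 := h2.continuous.comp hp
  refine (c2.inner (continuous_rot.comp c1)).div (c1.norm.pow 2) fun p => ?_
  exact pow_ne_zero 2 (norm_ne_zero_iff.mpr (Φ.regular p.1.2 (Subtype.coe_prop _)))

lemma SixthFlow.continuous_totalK {T : ℝ≥0∞} (Φ : SixthFlow T) :
    Continuous fun u : {t // inTime T t} => totalK (Φ.γ u) := by
  simp_rw [fun u : {t // inTime T t} => totalK_eq_integral_angSpeed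
    (Φ.differentiable_deriv u) (fun x hx => Φ.regular u.2 hx)]
  exact continuous_parametric_intervalIntegral_of_continuous' Φ.continuous_angSpeed _ _

lemma SixthFlow.sin_totalK_eq_zero {T : ℝ≥0∞} (Φ : SixthFlow T) {e : ℝ} (B : BC Φ e) {t : ℝ}
    (ht : inTime T t) : sin (totalK (Φ.γ t)) = 0 := by
  have hcont : Continuous fun x => angSpeed (Φ.γ t) (projIcc (-1 : ℝ) 1 (by norm_num) x) := by
    have h := Φ.continuous_angSpeed.comp
      (Continuous.prodMk_right (Y := ℝ) (⟨t, ht⟩ : {t // inTime T t}))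
    simpa only [Function.comp_def, Function.uncurry_apply_pair] using h
  exact _root_.sin_totalK_eq_zero (Φ.differentiable_deriv t) hcont
    (fun _ hx => Φ.regular ht hx) (B.neumann ht).1 (B.neumann ht).2

lemma preconnectedSpace_inTime (T : ℝ≥0∞) : PreconnectedSpace {t // inTime T t} := by
  refine Subtype.preconnectedSpace (s := {t | inTime T t}) (OrdConnected.isPreconnected ?_)
  exact ⟨fun a ha b hb c hc =>
    ⟨ha.1.trans hc.1, (ENNReal.ofReal_le_ofReal hc.2).trans_lt hb.2⟩⟩

/-- A continuous real function on a connected space whose sine vanishes is constant. -/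
lemma eq_of_forall_sin_eq_zero {X : Type*} [TopologicalSpace X] [PreconnectedSpace X]
    {f : X → ℝ} (hf : Continuous f) (hsin : ∀ x, sin (f x) = 0) (x y : X) : f x = f y := by
  choose n hn using fun x => sin_eq_zero_iff.mp (hsin x)
  have hnc : Continuous n :=
    Int.isClosedEmbedding_coe_real.isInducing.continuous_iff.mpr <|
      (hf.div_const π).congr fun x => by
        rw [← hn x, mul_div_cancel_right₀ _ pi_ne_zero, Function.comp_apply]
  rw [← hn x, ← hn y, PreconnectedSpace.constant inferInstance hnc (x := x) (y := y)]

lemma SixthFlow.totalK_eq {T : ℝ≥0∞} (Φ : SixthFlow T) {e : ℝ} (B : BC Φ e) {t : ℝ}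
    (ht : inTime T t) : totalK (Φ.γ t) = totalK (Φ.γ 0) :=
  have h0 : inTime T 0 := ⟨le_rfl, by simpa using Φ.Tpos⟩
  have := preconnectedSpace_inTime T
  eq_of_forall_sin_eq_zero Φ.continuous_totalK (fun u => Φ.sin_totalK_eq_zero B u.2)
    ⟨t, ht⟩ ⟨0, h0⟩

/-- **Conservation of total curvature / winding number.**  Under the flow with the stated
boundary conditions, `(d/dt) ∫_γ k ds = 0` on `[0,T)`; consequently the winding number
`ω(t) = (1/(2π)) ∫_γ k ds` is constant, and if `ω(0) = 0` then the average curvature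
`k̄(t) = (1/L(t)) ∫_γ k ds` vanishes identically. -/
theorem winding_number_constant {T : ℝ≥0∞} (Φ : SixthFlow T) (e : ℝ) (B : BC Φ e) :
    (∀ t : ℝ, inTime T t → HasDerivWithinAt (fun u => totalK (Φ.γ u)) 0 (Ici 0) t) ∧
    (∀ t : ℝ, inTime T t →
      1 / (2 * π) * totalK (Φ.γ t) = 1 / (2 * π) * totalK (Φ.γ 0)) ∧
    (1 / (2 * π) * totalK (Φ.γ 0) = 0 →
      ∀ t : ℝ, inTime T t → 1 / clen (Φ.γ t) * totalK (Φ.γ t) = 0) := by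
  refine ⟨fun t ht => ?_, fun t ht => by rw [Φ.totalK_eq B ht], fun h t ht => ?_⟩
  · have hev : ∀ᶠ u in nhdsWithin t (Ici 0), inTime T u :=
      eventually_mem_nhdsWithin.and <| nhdsWithin_le_nhds <|
        ENNReal.continuous_ofReal.continuousAt.eventually (gt_mem_nhds ht.2)
    exact (hasDerivWithinAt_const t (Ici 0) (totalK (Φ.γ 0))).congr_of_eventuallyEq
      (hev.mono fun u hu => Φ.totalK_eq B hu) (Φ.totalK_eq B ht)
  · have h0 : totalK (Φ.γ 0) = 0 := by simpa [pi_ne_zero] using h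
    rw [Φ.totalK_eq B ht, h0, mul_zero]
end
end

section
/- Under the flow with the stated boundary conditions, the length satisfies (d/dt) L(t) = − ∫_γ k F ds = − ∫_γ k_{ss}² ds + (7/2) ∫_γ k² k_s² ds. If moreover ω(t) = 0, then (d/dt) L(t) ≤ − [ 1 − (7 L(t)³/π³) ‖k_s(·,t)‖₂² ] ∫_γ k_{ss}² ds; in particular, if in addition 7 L(t)³ ‖k_s(·,t)‖₂² ≤ π³ for all t, then L(t) is non-increasing, and |e| ≤ L(t) ≤ L(0) for all t ∈ [0,T). -/
noncomputable section

open Real Set MeasureTheory intervalIntegral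
open scoped ENNReal RealInnerProductSpace

lemma contDiffOn_speed {c : ℝ → E2} (hc : ContDiff ℝ (⊤ : ℕ∞) c) :
    ContDiffOn ℝ (⊤ : ℕ∞) (fun x => ‖deriv c x‖) {x | deriv c x ≠ 0} := by
  have h : ContDiff ℝ (⊤ : ℕ∞) (deriv c) := (contDiff_infty_iff_deriv.1 hc).2
  exact h.contDiffOn.norm ℝ fun x hx => hx

lemma isOpen_regular {c : ℝ → E2} (hc : ContDiff ℝ (⊤ : ℕ∞) c) :
    IsOpen {x | deriv c x ≠ 0} :=
  isOpen_ne_fun (contDiff_infty_iff_deriv.1 hc).2.continuous continuous_const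

lemma contDiffOn_speed_inv {c : ℝ → E2} (hc : ContDiff ℝ (⊤ : ℕ∞) c) :
    ContDiffOn ℝ (⊤ : ℕ∞) (fun x => ‖deriv c x‖⁻¹) {x | deriv c x ≠ 0} :=
  (contDiffOn_speed hc).inv fun _ hx => norm_ne_zero_iff.2 hx

lemma contDiffOn_aderiv {c : ℝ → E2} (hc : ContDiff ℝ (⊤ : ℕ∞) c) {f : ℝ → ℝ}
    (hf : ContDiffOn ℝ (⊤ : ℕ∞) f {x | deriv c x ≠ 0}) :
    ContDiffOn ℝ (⊤ : ℕ∞) (aderiv c f) {x | deriv c x ≠ 0} :=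
  (contDiffOn_speed_inv hc).mul (hf.deriv_of_isOpen (isOpen_regular hc) le_rfl)

lemma contDiffOn_aderivVec {c : ℝ → E2} (hc : ContDiff ℝ (⊤ : ℕ∞) c) {f : ℝ → E2}
    (hf : ContDiffOn ℝ (⊤ : ℕ∞) f {x | deriv c x ≠ 0}) :
    ContDiffOn ℝ (⊤ : ℕ∞) (aderivVec c f) {x | deriv c x ≠ 0} :=
  (contDiffOn_speed_inv hc).smul (hf.deriv_of_isOpen (isOpen_regular hc) le_rfl)

lemma contDiffOn_utangent {c : ℝ → E2} (hc : ContDiff ℝ (⊤ : ℕ∞) c) :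
    ContDiffOn ℝ (⊤ : ℕ∞) (utangent c) {x | deriv c x ≠ 0} :=
  contDiffOn_aderivVec hc hc.contDiffOn

lemma contDiff_rot : ContDiff ℝ (⊤ : ℕ∞) rot := by
  rw [contDiff_euclidean]
  intro i
  fin_cases i
  · simp only [rot]; simp; fun_prop
  · simp only [rot]; simp; fun_prop

lemma inner_rot_self (v : E2) : ⟪v, rot v⟫ = 0 := by
  simp [rot, PiLp.inner_apply, Fin.sum_univ_two]; ring

lemma contDiffOn_curv {c : ℝ → E2} (hc : ContDiff ℝ (⊤ : ℕ∞) c) :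
    ContDiffOn ℝ (⊤ : ℕ∞) (curv c) {x | deriv c x ≠ 0} :=
  (contDiffOn_aderivVec hc (contDiffOn_utangent hc)).inner ℝ
    (contDiff_rot.comp_contDiffOn (contDiffOn_utangent hc))

lemma contDiffOn_kds {c : ℝ → E2} (hc : ContDiff ℝ (⊤ : ℕ∞) c) (j : ℕ) :
    ContDiffOn ℝ (⊤ : ℕ∞) (kds c j) {x | deriv c x ≠ 0} := by
  induction j with
  | zero => exact contDiffOn_curv hc
  | succ n ih => exact contDiffOn_aderiv hc ih

lemma hasDerivAt_kds {c : ℝ → E2} (hc : ContDiff ℝ (⊤ : ℕ∞) c) (j : ℕ) {x : ℝ}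
    (hx : deriv c x ≠ 0) :
    HasDerivAt (kds c j) (‖deriv c x‖ * kds c (j + 1) x) x := by
  have h := ((contDiffOn_kds hc j).contDiffAt ((isOpen_regular hc).mem_nhds hx)).differentiableAt
    (by simp) |>.hasDerivAt
  refine h.congr_deriv ?_
  change _ = ‖deriv c x‖ * (‖deriv c x‖⁻¹ * deriv (kds c j) x)
  rw [mul_inv_cancel_left₀ (norm_ne_zero_iff.2 hx)]

/-- The integral over a curve with `k_s = k_{sss} = 0` at its ends, after integrating by parts. -/
lemma cint_curv_mul_speedF {c : ℝ → E2} (hc : ContDiff ℝ (⊤ : ℕ∞) c)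
    (hreg : ∀ x ∈ Icc (-1 : ℝ) 1, deriv c x ≠ 0)
    (h1 : kds c 1 (-1) = 0 ∧ kds c 1 1 = 0) (h3 : kds c 3 (-1) = 0 ∧ kds c 3 1 = 0) :
    cint c (fun x => curv c x * speedF c x)
      = knorm2 c 2 - 7 / 2 * cint c (fun x => (curv c x) ^ 2 * (kds c 1 x) ^ 2) := by
  have hk : ∀ j, ContinuousOn (kds c j) (uIcc (-1 : ℝ) 1) := fun j => by
    rw [uIcc_of_le (by norm_num)]
    exact (contDiffOn_kds hc j).continuousOn.mono hreg
  have hk0 : ContinuousOn (curv c) (uIcc (-1 : ℝ) 1) := hk 0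
  have hw : ContinuousOn (fun x => ‖deriv c x‖) (uIcc (-1 : ℝ) 1) :=
    (contDiff_infty_iff_deriv.1 hc).2.continuous.norm.continuousOn
  have k1 := hk 1
  have k2 := hk 2
  have k3 := hk 3
  have k4 := hk 4
  have hF : ContinuousOn (fun x => curv c x * speedF c x * ‖deriv c x‖) (uIcc (-1 : ℝ) 1) := by
    unfold speedF; fun_prop
  have hB : ContinuousOn (fun x => (kds c 2 x) ^ 2 * ‖deriv c x‖) (uIcc (-1 : ℝ) 1) := by
    fun_prop
  have hC : ContinuousOn (fun x => (curv c x) ^ 2 * (kds c 1 x) ^ 2 * ‖deriv c x‖)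
      (uIcc (-1 : ℝ) 1) := by
    fun_prop
  have hint : ∫ x in (-1 : ℝ)..1, (curv c x * speedF c x * ‖deriv c x‖
      - (kds c 2 x) ^ 2 * ‖deriv c x‖
      + 7 / 2 * ((curv c x) ^ 2 * (kds c 1 x) ^ 2 * ‖deriv c x‖)) = 0 := by
    rw [integral_eq_sub_of_hasDerivAt (f := fun x => curv c x * kds c 3 x
      - kds c 1 x * kds c 2 x + curv c x ^ 3 * kds c 1 x)]
    · simp [h1.1, h1.2, h3.1, h3.2]
    · intro x hx
      rw [uIcc_of_le (by norm_num)] at hx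
      have d0 : HasDerivAt (curv c) _ x := hasDerivAt_kds hc 0 (hreg x hx)
      have d1 := hasDerivAt_kds hc 1 (hreg x hx)
      have d2 := hasDerivAt_kds hc 2 (hreg x hx)
      have d3 := hasDerivAt_kds hc 3 (hreg x hx)
      refine HasDerivAt.congr_deriv (((d0.mul d3).sub (d1.mul d2)).add ((d0.pow 3).mul d1)) ?_
      simp only [speedF, Pi.pow_apply]; push_cast; ring
    · exact ((hF.sub hB).add (continuousOn_const.mul hC)).intervalIntegrable
  rw [intervalIntegral.integral_add (hF.intervalIntegrable.sub hB.intervalIntegrable)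
    (hC.intervalIntegrable.const_mul _),
    intervalIntegral.integral_sub hF.intervalIntegrable hB.intervalIntegrable,
    intervalIntegral.integral_const_mul] at hint
  simp only [knorm2, cint]
  linarith

/-- Weighted Young inequality for integrals. -/
lemma two_mul_integral_mul_le {u v a : ℝ} (huv : u ≤ v) {φ w g : ℝ → ℝ}
    (hφ : ContinuousOn φ (Icc u v)) (hw : ContinuousOn w (Icc u v))
    (hg : ContinuousOn g (Icc u v)) (hw0 : ∀ x ∈ Icc u v, 0 ≤ w x) :
    2 * a * ∫ x in u..v, φ x * (w x * g x)
      ≤ (∫ x in u..v, φ x ^ 2 * w x) + a ^ 2 * ∫ x in u..v, g x ^ 2 * w x := by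
  rw [← uIcc_of_le huv] at hφ hw hg
  rw [← intervalIntegral.integral_const_mul, ← intervalIntegral.integral_const_mul,
    ← intervalIntegral.integral_add
      (ContinuousOn.intervalIntegrable (by fun_prop))
      (ContinuousOn.intervalIntegrable (by fun_prop))]
  refine intervalIntegral.integral_mono_on huv (ContinuousOn.intervalIntegrable (by fun_prop))
    (ContinuousOn.intervalIntegrable (by fun_prop)) fun x hx => ?_
  nlinarith [mul_nonneg (hw0 x hx) (sq_nonneg (φ x - a * g x))]

lemma sq_le_mul_of_forall_young {p A N : ℝ} (h : ∀ a : ℝ, 2 * a * p ≤ A + a ^ 2 * N) :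
    p ^ 2 ≤ A * N := by
  have := discrim_le_zero (a := N) (b := -2 * p) (c := A) fun a => by nlinarith [h a]
  simp only [discrim] at this
  nlinarith

section Arclength

variable {w h g : ℝ → ℝ}

/-- Sup bound for functions with zero mean, in an arbitrary parametrization. -/
lemma sq_le_of_integral_eq_zero {s : ℝ → ℝ} {L : ℝ}
    (hs : ∀ x ∈ Icc (-1 : ℝ) 1, HasDerivAt s (w x) x) (hs0 : s (-1) = 0) (hs1 : s 1 = L)
    (hL : 0 < L) (hw : ContinuousOn w (Icc (-1) 1)) (hw0 : ∀ x ∈ Icc (-1 : ℝ) 1, 0 ≤ w x)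
    (hsI : ∀ x ∈ Icc (-1 : ℝ) 1, s x ∈ Icc 0 L)
    (hg : ContinuousOn g (Icc (-1) 1))
    (hh : ∀ x ∈ Icc (-1 : ℝ) 1, HasDerivAt h (w x * g x) x)
    (hmean : ∫ x in (-1 : ℝ)..1, h x * w x = 0) {x : ℝ} (hx : x ∈ Icc (-1 : ℝ) 1) :
    h x ^ 2 ≤ L / 3 * ∫ x in (-1 : ℝ)..1, g x ^ 2 * w x := by
  set N := ∫ x in (-1 : ℝ)..1, g x ^ 2 * w x with hN
  have sub1 : Icc (-1) x ⊆ Icc (-1 : ℝ) 1 := Icc_subset_Icc le_rfl hx.2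
  have sub2 : Icc x 1 ⊆ Icc (-1 : ℝ) 1 := Icc_subset_Icc hx.1 le_rfl
  have hsc : ContinuousOn s (Icc (-1) 1) := fun y hy => (hs y hy).continuousAt.continuousWithinAt
  have hhc : ContinuousOn h (Icc (-1) 1) := fun y hy => (hh y hy).continuousAt.continuousWithinAt
  have key : ∀ {u v : ℝ} (b : ℝ), u ≤ v → Icc u v ⊆ Icc (-1 : ℝ) 1 →
      (∫ y in u..v, (s y - b) * (w y * g y)) + ∫ y in u..v, h y * w y
        = (s v - b) * h v - (s u - b) * h u := by
    intro u v b huv hsub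
    have c1 := hsc.mono hsub
    have c2 := hhc.mono hsub
    have c3 := hg.mono hsub
    have c4 := hw.mono hsub
    rw [← uIcc_of_le huv] at c1 c2 c3 c4
    rw [← intervalIntegral.integral_add (ContinuousOn.intervalIntegrable (by fun_prop))
      (ContinuousOn.intervalIntegrable (by fun_prop)),
      ← integral_eq_sub_of_hasDerivAt (f := fun y => (s y - b) * h y)
        (f' := fun y => (s y - b) * (w y * g y) + h y * w y)]
    · intro y hy
      rw [uIcc_of_le huv] at hy
      refine HasDerivAt.congr_deriv (((hs y (hsub hy)).sub_const b).mul (hh y (hsub hy))) ?_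
      ring
    · exact ContinuousOn.intervalIntegrable (by fun_prop)
  have cube : ∀ {u v : ℝ} (b : ℝ), u ≤ v → Icc u v ⊆ Icc (-1 : ℝ) 1 →
      (∫ y in u..v, (s y - b) ^ 2 * w y) = (s v - b) ^ 3 / 3 - (s u - b) ^ 3 / 3 := by
    intro u v b huv hsub
    have c1 := hsc.mono hsub
    have c4 := hw.mono hsub
    rw [← uIcc_of_le huv] at c1 c4
    rw [← integral_eq_sub_of_hasDerivAt (f := fun y => (s y - b) ^ 3 / 3)]
    · intro y hy
      rw [uIcc_of_le huv] at hy
      refine HasDerivAt.congr_deriv ((((hs y (hsub hy)).sub_const b).pow 3).div_const 3) ?_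
      push_cast; ring
    · exact ContinuousOn.intervalIntegrable (by fun_prop)
  have split : ∀ f : ℝ → ℝ, ContinuousOn f (Icc (-1) 1) →
      (∫ y in (-1 : ℝ)..x, f y) + ∫ y in x..1, f y = ∫ y in (-1 : ℝ)..1, f y := fun f hf =>
    integral_add_adjacent_intervals
      (ContinuousOn.intervalIntegrable (by rw [uIcc_of_le hx.1]; exact hf.mono sub1))
      (ContinuousOn.intervalIntegrable (by rw [uIcc_of_le hx.2]; exact hf.mono sub2))
  have e1 := key 0 hx.1 sub1
  have e2 := key L hx.2 sub2
  have m := split (fun y => h y * w y) (hhc.mul hw)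
  have n := split (fun y => g y ^ 2 * w y) (by fun_prop)
  have c1 := cube 0 hx.1 sub1
  have c2 := cube L hx.2 sub2
  rw [hs0] at e1 c1
  rw [hs1] at e2 c2
  obtain ⟨hx0, hxL⟩ := hsI x hx
  have hy : (L * h x) ^ 2 ≤ L ^ 3 / 3 * N := by
    apply sq_le_mul_of_forall_young
    intro a
    have y1 := two_mul_integral_mul_le (a := a) hx.1 ((hsc.mono sub1).sub continuousOn_const)
      (hw.mono sub1) (hg.mono sub1) (fun y hy => hw0 y (sub1 hy)) (φ := fun y => s y - 0)
    have y2 := two_mul_integral_mul_le (a := a) hx.2 ((hsc.mono sub2).sub continuousOn_const)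
      (hw.mono sub2) (hg.mono sub2) (fun y hy => hw0 y (sub2 hy)) (φ := fun y => s y - L)
    have e : L * h x = (∫ y in (-1 : ℝ)..x, (s y - 0) * (w y * g y))
        + ∫ y in x..1, (s y - L) * (w y * g y) := by linarith
    have hp : 0 ≤ L * s x * (L - s x) := mul_nonneg (mul_nonneg hL.le hx0) (sub_nonneg.2 hxL)
    rw [e, hN, ← n]
    rw [c1] at y1
    rw [c2] at y2
    nlinarith
  have hL2 : 0 < L ^ 2 := by positivity
  refine le_of_mul_le_mul_left ?_ hL2
  calc L ^ 2 * h x ^ 2 = (L * h x) ^ 2 := by ring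
    _ ≤ _ := hy
    _ = _ := by ring

/-- A Poincaré inequality for functions vanishing at both ends, in an arbitrary
parametrization. -/
lemma integral_sq_le_of_eq_zero {s : ℝ → ℝ} {L : ℝ}
    (hs : ∀ x ∈ Icc (-1 : ℝ) 1, HasDerivAt s (w x) x) (hs0 : s (-1) = 0) (hs1 : s 1 = L)
    (hL : 0 < L) (hw : ContinuousOn w (Icc (-1) 1)) (hw0 : ∀ x ∈ Icc (-1 : ℝ) 1, 0 ≤ w x)
    (hg : ContinuousOn g (Icc (-1) 1))
    (hh : ∀ x ∈ Icc (-1 : ℝ) 1, HasDerivAt h (w x * g x) x)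
    (h0 : h (-1) = 0) (h1 : h 1 = 0) :
    ∫ x in (-1 : ℝ)..1, h x ^ 2 * w x ≤ L ^ 2 / 6 * ∫ x in (-1 : ℝ)..1, g x ^ 2 * w x := by
  set N := ∫ x in (-1 : ℝ)..1, g x ^ 2 * w x with hN
  have hsc : ContinuousOn s (Icc (-1) 1) := fun y hy => (hs y hy).continuousAt.continuousWithinAt
  have hhc : ContinuousOn h (Icc (-1) 1) := fun y hy => (hh y hy).continuousAt.continuousWithinAt
  have pt : ∀ x ∈ Icc (-1 : ℝ) 1, h x ^ 2 * w x ≤ N / L * (s x * (L - s x) * w x) := by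
    intro x hx
    have sub1 : Icc (-1) x ⊆ Icc (-1 : ℝ) 1 := Icc_subset_Icc le_rfl hx.2
    have sub2 : Icc x 1 ⊆ Icc (-1 : ℝ) 1 := Icc_subset_Icc hx.1 le_rfl
    have key : ∀ {u v : ℝ} (b : ℝ), u ≤ v → Icc u v ⊆ Icc (-1 : ℝ) 1 →
        (∫ y in u..v, b * (w y * g y)) = b * (h v - h u) := by
      intro u v b huv hsub
      have c3 := hg.mono hsub
      have c4 := hw.mono hsub
      rw [← uIcc_of_le huv] at c3 c4
      rw [intervalIntegral.integral_const_mul, integral_eq_sub_of_hasDerivAt]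
      · intro y hy
        rw [uIcc_of_le huv] at hy
        exact hh y (hsub hy)
      · exact ContinuousOn.intervalIntegrable (by fun_prop)
    have cst : ∀ {u v : ℝ} (b : ℝ), u ≤ v → Icc u v ⊆ Icc (-1 : ℝ) 1 →
        (∫ y in u..v, b ^ 2 * w y) = b ^ 2 * (s v - s u) := by
      intro u v b huv hsub
      have c4 := hw.mono hsub
      rw [← uIcc_of_le huv] at c4
      rw [intervalIntegral.integral_const_mul, integral_eq_sub_of_hasDerivAt]
      · intro y hy
        rw [uIcc_of_le huv] at hy
        exact hs y (hsub hy)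
      · exact c4.intervalIntegrable
    have n : (∫ y in (-1 : ℝ)..x, g y ^ 2 * w y) + ∫ y in x..1, g y ^ 2 * w y = N :=
      have hc : ContinuousOn (fun y => g y ^ 2 * w y) (Icc (-1) 1) := by fun_prop
      integral_add_adjacent_intervals
        (ContinuousOn.intervalIntegrable (by rw [uIcc_of_le hx.1]; exact hc.mono sub1))
        (ContinuousOn.intervalIntegrable (by rw [uIcc_of_le hx.2]; exact hc.mono sub2))
    have hy : (L * h x) ^ 2 ≤ L * s x * (L - s x) * N := by
      apply sq_le_mul_of_forall_young
      intro a
      have y1 := two_mul_integral_mul_le (a := a) hx.1 continuousOn_const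
        (hw.mono sub1) (hg.mono sub1) (fun y hy => hw0 y (sub1 hy)) (φ := fun _ => L - s x)
      have y2 := two_mul_integral_mul_le (a := a) hx.2 continuousOn_const
        (hw.mono sub2) (hg.mono sub2) (fun y hy => hw0 y (sub2 hy)) (φ := fun _ => -s x)
      rw [key _ hx.1 sub1, cst _ hx.1 sub1, h0, hs0] at y1
      rw [key _ hx.2 sub2, cst _ hx.2 sub2, h1, hs1] at y2
      rw [← n]
      nlinarith
    have hL2 : 0 < L ^ 2 := by positivity
    have : h x ^ 2 ≤ N / L * (s x * (L - s x)) := by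
      refine le_of_mul_le_mul_left ?_ hL2
      calc L ^ 2 * h x ^ 2 = (L * h x) ^ 2 := by ring
        _ ≤ _ := hy
        _ = _ := by field_simp
    calc _ ≤ N / L * (s x * (L - s x)) * w x := mul_le_mul_of_nonneg_right this (hw0 x hx)
      _ = _ := by ring
  have le : (-1 : ℝ) ≤ 1 := by norm_num
  have hval : ∫ x in (-1 : ℝ)..1, s x * (L - s x) * w x = L ^ 3 / 6 := by
    rw [integral_eq_sub_of_hasDerivAt (f := fun y => L / 2 * s y ^ 2 - s y ^ 3 / 3)]
    · simp only [hs0, hs1]; ring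
    · intro y hy
      rw [uIcc_of_le le] at hy
      refine HasDerivAt.congr_deriv ((((hs y hy).pow 2).const_mul (L / 2)).sub (((hs y hy).pow 3).div_const 3)) ?_
      push_cast; ring
    · exact ContinuousOn.intervalIntegrable (by rw [uIcc_of_le le]; fun_prop)
  calc _ ≤ ∫ x in (-1 : ℝ)..1, N / L * (s x * (L - s x) * w x) :=
        intervalIntegral.integral_mono_on le
          (ContinuousOn.intervalIntegrable (by rw [uIcc_of_le le]; fun_prop))
          (ContinuousOn.intervalIntegrable (by rw [uIcc_of_le le]; fun_prop)) pt
    _ = L ^ 2 / 6 * N := by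
        rw [intervalIntegral.integral_const_mul, hval]; field_simp

end Arclength

lemma continuous_speed {c : ℝ → E2} (hc : ContDiff ℝ (⊤ : ℕ∞) c) :
    Continuous fun x => ‖deriv c x‖ :=
  (contDiff_infty_iff_deriv.1 hc).2.continuous.norm

lemma clen_eq (c : ℝ → E2) : clen c = ∫ x in (-1 : ℝ)..1, ‖deriv c x‖ := by
  simp [clen, cint]

lemma knorm2_nonneg (c : ℝ → E2) (j : ℕ) : 0 ≤ knorm2 c j :=
  intervalIntegral.integral_nonneg (by norm_num) fun _ _ => by positivity

lemma clen_pos {c : ℝ → E2} (hc : ContDiff ℝ (⊤ : ℕ∞) c)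
    (hreg : ∀ x ∈ Icc (-1 : ℝ) 1, deriv c x ≠ 0) : 0 < clen c := by
  rw [clen_eq]
  exact intervalIntegral_pos_of_pos_on ((continuous_speed hc).intervalIntegrable _ _)
    (fun x hx => norm_pos_iff.2 (hreg x (Ioo_subset_Icc_self hx))) (by norm_num)

/-- Scale-invariant interpolation estimate for curves with zero total curvature and `k_s = 0` at
the ends. -/
lemma cint_curv_sq_mul_le {c : ℝ → E2} (hc : ContDiff ℝ (⊤ : ℕ∞) c)
    (hreg : ∀ x ∈ Icc (-1 : ℝ) 1, deriv c x ≠ 0)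
    (h1 : kds c 1 (-1) = 0 ∧ kds c 1 1 = 0) (hK : totalK c = 0) :
    cint c (fun x => (curv c x) ^ 2 * (kds c 1 x) ^ 2)
      ≤ clen c ^ 3 / 18 * knorm2 c 1 * knorm2 c 2 := by
  have le : (-1 : ℝ) ≤ 1 := by norm_num
  have hwc := continuous_speed hc
  have hk : ∀ j, ContinuousOn (kds c j) (Icc (-1 : ℝ) 1) := fun j =>
    (contDiffOn_kds hc j).continuousOn.mono hreg
  have hL := clen_pos hc hreg
  have hs : ∀ x, HasDerivAt (fun y => ∫ z in (-1 : ℝ)..y, ‖deriv c z‖) ‖deriv c x‖ x := fun x =>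
    hwc.integral_hasStrictDerivAt (-1) x |>.hasDerivAt
  have hs1 := (clen_eq c).symm
  have hsI : ∀ x ∈ Icc (-1 : ℝ) 1, (∫ z in (-1 : ℝ)..x, ‖deriv c z‖) ∈ Icc 0 (clen c) := by
    intro x hx
    refine ⟨intervalIntegral.integral_nonneg hx.1 fun _ _ => norm_nonneg _, ?_⟩
    rw [clen_eq, ← integral_add_adjacent_intervals (hwc.intervalIntegrable (-1) x)
      (hwc.intervalIntegrable x 1)]
    exact le_add_of_nonneg_right
      (intervalIntegral.integral_nonneg hx.2 fun _ _ => norm_nonneg _)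
  have sup : ∀ x ∈ Icc (-1 : ℝ) 1, curv c x ^ 2 ≤ clen c / 3 * knorm2 c 1 := fun x hx =>
    sq_le_of_integral_eq_zero (fun y _ => hs y) (by simp) hs1 hL hwc.continuousOn
      (fun _ _ => norm_nonneg _) hsI (hk 1) (fun y hy => hasDerivAt_kds hc 0 (hreg y hy)) hK hx
  have poin : knorm2 c 1 ≤ clen c ^ 2 / 6 * knorm2 c 2 :=
    integral_sq_le_of_eq_zero (fun y _ => hs y) (by simp) hs1 hL hwc.continuousOn
      (fun _ _ => norm_nonneg _) (hk 2) (fun y hy => hasDerivAt_kds hc 1 (hreg y hy)) h1.1 h1.2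
  have k0 : ContinuousOn (curv c) (uIcc (-1 : ℝ) 1) := by rw [uIcc_of_le le]; exact hk 0
  have k1 : ContinuousOn (kds c 1) (uIcc (-1 : ℝ) 1) := by rw [uIcc_of_le le]; exact hk 1
  have hw := hwc.continuousOn (s := uIcc (-1 : ℝ) 1)
  have N1 := knorm2_nonneg c 1
  calc cint c (fun x => (curv c x) ^ 2 * (kds c 1 x) ^ 2)
      ≤ ∫ x in (-1 : ℝ)..1, clen c / 3 * knorm2 c 1 * (kds c 1 x ^ 2 * ‖deriv c x‖) := by
        refine intervalIntegral.integral_mono_on le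
          (ContinuousOn.mul (by fun_prop) hw).intervalIntegrable
          ((ContinuousOn.mul (by fun_prop) hw).intervalIntegrable.const_mul _) fun x hx => ?_
        rw [mul_assoc]
        exact mul_le_mul_of_nonneg_right (sup x hx) (by positivity)
    _ = clen c / 3 * knorm2 c 1 * knorm2 c 1 := by
        rw [intervalIntegral.integral_const_mul]; rfl
    _ ≤ clen c / 3 * knorm2 c 1 * (clen c ^ 2 / 6 * knorm2 c 2) :=
        mul_le_mul_of_nonneg_left poin (by positivity)
    _ = _ := by ring

lemma abs_sub_le_clen {c : ℝ → E2} (hc : ContDiff ℝ (⊤ : ℕ∞) c) :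
    |c 1 0 - c (-1) 0| ≤ clen c := by
  have hd := (contDiff_infty_iff_deriv.1 hc).2.continuous
  have h : ∫ x in (-1 : ℝ)..1, deriv c x = c 1 - c (-1) :=
    integral_deriv_eq_sub (fun x _ => hc.differentiable (by simp) x)
      (hd.intervalIntegrable _ _)
  calc |c 1 0 - c (-1) 0| = ‖(c 1 - c (-1)) 0‖ := by simp
    _ ≤ ‖c 1 - c (-1)‖ := PiLp.norm_apply_le _ _
    _ ≤ clen c := by
        rw [← h, clen_eq]
        exact intervalIntegral.norm_integral_le_integral_norm (by norm_num)

section Variation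

variable {γ : ℝ → ℝ → E2}

lemma contDiff_slice (hγ : ContDiff ℝ (⊤ : ℕ∞) (Function.uncurry γ)) (t : ℝ) :
    ContDiff ℝ (⊤ : ℕ∞) (γ t) :=
  hγ.comp (contDiff_const.prodMk contDiff_id)

lemma hasDerivAt_slice_right (hγ : ContDiff ℝ (⊤ : ℕ∞) (Function.uncurry γ)) (t x : ℝ) :
    HasDerivAt (γ t) (fderiv ℝ (Function.uncurry γ) (t, x) (0, 1)) x :=
  (hγ.differentiable (by simp) (t, x)).hasFDerivAt.comp_hasDerivAt x
    ((hasDerivAt_const x t).prodMk (hasDerivAt_id x))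

lemma hasDerivAt_slice_left (hγ : ContDiff ℝ (⊤ : ℕ∞) (Function.uncurry γ)) (t x : ℝ) :
    HasDerivAt (fun u => γ u x) (fderiv ℝ (Function.uncurry γ) (t, x) (1, 0)) t :=
  (hγ.differentiable (by simp) (t, x)).hasFDerivAt.comp_hasDerivAt (f := fun u => (u, x)) t
    ((hasDerivAt_id t).prodMk (hasDerivAt_const t x))

lemma contDiff_fderiv_uncurry (hγ : ContDiff ℝ (⊤ : ℕ∞) (Function.uncurry γ)) :
    ContDiff ℝ (⊤ : ℕ∞) (fderiv ℝ (Function.uncurry γ)) :=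
  hγ.fderiv_right le_rfl

lemma hasDerivAt_deriv_slice (hγ : ContDiff ℝ (⊤ : ℕ∞) (Function.uncurry γ)) (t x : ℝ) :
    HasDerivAt (fun u => deriv (γ u) x)
      (fderiv ℝ (fderiv ℝ (Function.uncurry γ)) (t, x) (1, 0) (0, 1)) t := by
  have e : (fun u => deriv (γ u) x)
      = fun u => fderiv ℝ (Function.uncurry γ) (u, x) (0, 1) :=
    funext fun u => (hasDerivAt_slice_right hγ u x).deriv
  rw [e]
  have h := ((contDiff_fderiv_uncurry hγ).differentiable (by simp) (t, x)).hasFDerivAt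
    |>.comp_hasDerivAt t ((hasDerivAt_id t).prodMk (hasDerivAt_const t x))
  exact h.clm_apply (hasDerivAt_const t ((0, 1) : ℝ × ℝ)) |>.congr_deriv (by simp)

lemma hasDerivAt_velocity (hγ : ContDiff ℝ (⊤ : ℕ∞) (Function.uncurry γ)) (t x : ℝ) :
    HasDerivAt (fun y => fderiv ℝ (Function.uncurry γ) (t, y) (1, 0))
      (fderiv ℝ (fderiv ℝ (Function.uncurry γ)) (t, x) (1, 0) (0, 1)) x := by
  have h := ((contDiff_fderiv_uncurry hγ).differentiable (by simp) (t, x)).hasFDerivAt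
    |>.comp_hasDerivAt x ((hasDerivAt_const x t).prodMk (hasDerivAt_id x))
  have sym : IsSymmSndFDerivAt ℝ (Function.uncurry γ) (t, x) :=
    hγ.contDiffAt.isSymmSndFDerivAt (by simp; exact WithTop.coe_le_coe.2 le_top)
  rw [sym.eq]
  exact h.clm_apply (hasDerivAt_const x ((1, 0) : ℝ × ℝ)) |>.congr_deriv (by simp)

lemma continuous_mixed (hγ : ContDiff ℝ (⊤ : ℕ∞) (Function.uncurry γ)) :
    Continuous fun p : ℝ × ℝ => fderiv ℝ (fderiv ℝ (Function.uncurry γ)) p (1, 0) (0, 1) :=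
  (((contDiff_fderiv_uncurry hγ).continuous_fderiv (by simp)).clm_apply
    continuous_const).clm_apply continuous_const

/-- Derivative of the length of a smooth family of curves at a regular curve. -/
lemma hasDerivAt_clen (hγ : ContDiff ℝ (⊤ : ℕ∞) (Function.uncurry γ)) {t : ℝ}
    (hreg : ∀ x ∈ Icc (-1 : ℝ) 1, deriv (γ t) x ≠ 0) :
    HasDerivAt (fun u => clen (γ u)) (∫ x in (-1 : ℝ)..1,
      ⟪utangent (γ t) x, fderiv ℝ (fderiv ℝ (Function.uncurry γ)) (t, x) (1, 0) (0, 1)⟫) t := by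
  simp only [clen_eq]
  set M : ℝ × ℝ → E2 := fun p => fderiv ℝ (fderiv ℝ (Function.uncurry γ)) p (1, 0) (0, 1)
  have hM : Continuous M := continuous_mixed hγ
  obtain ⟨C, hC⟩ := ((isCompact_Icc (a := t - 1) (b := t + 1)).prod
    (isCompact_Icc (a := (-1 : ℝ)) (b := 1))).exists_bound_of_continuousOn hM.continuousOn
  have hsub : uIoc (-1 : ℝ) 1 ⊆ Icc (-1 : ℝ) 1 := by
    rw [uIoc_of_le (by norm_num)]; exact Ioc_subset_Icc_self
  have htan : ContinuousOn (utangent (γ t)) (Icc (-1) 1) :=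
    (contDiffOn_utangent (contDiff_slice hγ t)).continuousOn.mono hreg
  refine (intervalIntegral.hasDerivAt_integral_of_dominated_loc_of_lip
    (F := fun u x => ‖deriv (γ u) x‖) (bound := fun _ => C) (Metric.ball_mem_nhds t one_pos)
    (Filter.Eventually.of_forall fun u =>
      (continuous_speed (contDiff_slice hγ u)).aestronglyMeasurable)
    ((continuous_speed (contDiff_slice hγ t)).intervalIntegrable _ _) ?_ ?_
    intervalIntegrable_const ?_).2
  · refine ContinuousOn.aestronglyMeasurable ?_ measurableSet_uIoc
    exact (htan.mono hsub).inner
      (hM.comp (by fun_prop : Continuous fun x => (t, x))).continuousOn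
  · refine Filter.Eventually.of_forall fun x hx => LipschitzOnWith.of_dist_le_mul ?_
    intro u hu v hv
    have hmv := (convex_ball t 1).norm_image_sub_le_of_norm_hasDerivWithin_le
      (f := fun u => deriv (γ u) x) (C := C)
      (fun y _ => (hasDerivAt_deriv_slice hγ y x).hasDerivWithinAt)
      (fun y hy => hC (y, x) ⟨by
        rw [Metric.mem_ball, Real.dist_eq, abs_lt] at hy
        constructor <;> linarith [hy.1, hy.2], hsub hx⟩) hv hu
    rw [Real.dist_eq, Real.dist_eq]
    calc _ ≤ ‖deriv (γ u) x - deriv (γ v) x‖ := abs_norm_sub_norm_le _ _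
      _ ≤ C * |u - v| := hmv
      _ ≤ _ := mul_le_mul_of_nonneg_right (by simpa using le_abs_self C) (abs_nonneg _)
  · refine Filter.Eventually.of_forall fun x hx => ?_
    have h0 := hreg x (hsub hx)
    have hd := (hasDerivAt_deriv_slice hγ t x).norm_sq.sqrt (by positivity)
    simp only [Real.sqrt_sq (norm_nonneg _)] at hd
    refine hd.congr_deriv ?_
    simp only [utangent, aderivVec, inner_smul_left]
    have := norm_pos_iff.2 h0
    simp
    field_simp

lemma eq_of_hasDerivWithinAt_Ici {f : ℝ → E2} {a b : E2} {t : ℝ} (ht : 0 ≤ t)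
    (h₁ : HasDerivWithinAt f a (Ici 0) t) (h₂ : HasDerivAt f b t) : a = b :=
  (uniqueDiffOn_Ici (0 : ℝ) t ht).eq_deriv _ h₁ h₂.hasDerivWithinAt

/-- First variation of length under a normal velocity. -/
lemma integral_utangent_mixed (hγ : ContDiff ℝ (⊤ : ℕ∞) (Function.uncurry γ)) {t : ℝ}
    (hreg : ∀ x ∈ Icc (-1 : ℝ) 1, deriv (γ t) x ≠ 0) {F : ℝ → ℝ}
    (hF : ∀ x ∈ Icc (-1 : ℝ) 1,
      fderiv ℝ (Function.uncurry γ) (t, x) (1, 0) = F x • unormal (γ t) x) :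
    ∫ x in (-1 : ℝ)..1,
      ⟪utangent (γ t) x, fderiv ℝ (fderiv ℝ (Function.uncurry γ)) (t, x) (1, 0) (0, 1)⟫
      = -cint (γ t) (fun x => curv (γ t) x * F x) := by
  have le : (-1 : ℝ) ≤ 1 := by norm_num
  have hc := contDiff_slice hγ t
  have hU := isOpen_regular hc
  have htan := contDiffOn_utangent hc
  have hdtan : ContinuousOn (deriv (utangent (γ t))) (uIcc (-1) 1) := by
    rw [uIcc_of_le le]
    exact (htan.continuousOn_deriv_of_isOpen hU (by simp)).mono hreg
  have hvel : Continuous fun x => fderiv ℝ (Function.uncurry γ) (t, x) (1, 0) :=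
    continuous_iff_continuousAt.2 fun x => (hasDerivAt_velocity hγ t x).continuousAt
  have hM : Continuous fun x =>
      fderiv ℝ (fderiv ℝ (Function.uncurry γ)) (t, x) (1, 0) (0, 1) :=
    (continuous_mixed hγ).comp (by fun_prop : Continuous fun x => (t, x))
  have htanc : ContinuousOn (utangent (γ t)) (uIcc (-1) 1) := by
    rw [uIcc_of_le le]; exact htan.continuousOn.mono hreg
  have i1 : IntervalIntegrable (fun x => ⟪utangent (γ t) x,
      fderiv ℝ (fderiv ℝ (Function.uncurry γ)) (t, x) (1, 0) (0, 1)⟫) volume (-1) 1 :=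
    (htanc.inner hM.continuousOn).intervalIntegrable
  have i2 : IntervalIntegrable (fun x => ⟪deriv (utangent (γ t)) x,
      fderiv ℝ (Function.uncurry γ) (t, x) (1, 0)⟫) volume (-1) 1 :=
    (hdtan.inner hvel.continuousOn).intervalIntegrable
  have hperp : ∀ x ∈ Icc (-1 : ℝ) 1, ⟪utangent (γ t) x,
      fderiv ℝ (Function.uncurry γ) (t, x) (1, 0)⟫ = 0 := fun x hx => by
    rw [hF x hx, inner_smul_right, unormal, inner_rot_self, mul_zero]
  have hparts := integral_eq_sub_of_hasDerivAt (a := -1) (b := 1)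
    (f := fun x => ⟪utangent (γ t) x, fderiv ℝ (Function.uncurry γ) (t, x) (1, 0)⟫)
    (fun x hx => by
      rw [uIcc_of_le le] at hx
      exact ((htan.contDiffAt (hU.mem_nhds (hreg x hx))).differentiableAt
        (by simp)).hasDerivAt.inner ℝ (hasDerivAt_velocity hγ t x)) (i1.add i2)
  rw [hperp 1 (by simp), hperp (-1) (by simp), intervalIntegral.integral_add i1 i2] at hparts
  have e : ∫ x in (-1 : ℝ)..1, ⟪deriv (utangent (γ t)) x,
      fderiv ℝ (Function.uncurry γ) (t, x) (1, 0)⟫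
      = cint (γ t) (fun x => curv (γ t) x * F x) := by
    refine intervalIntegral.integral_congr fun x hx => ?_
    rw [uIcc_of_le le] at hx
    have := norm_pos_iff.2 (hreg x hx)
    simp only [hF x hx, curv, aderivVec, inner_smul_left, inner_smul_right]
    simp
    field_simp
  linarith

end Variation

/-- **Evolution of the length.**  Under the flow with the stated boundary conditions,
`(d/dt) L = -∫_γ k F ds = -∫_γ k_{ss}² ds + (7/2) ∫_γ k² k_s² ds`.  If moreover `ω(t) = 0`
then `(d/dt) L ≤ -[1 - (7L³/π³)‖k_s‖₂²] ∫_γ k_{ss}² ds`; in particular, if in addition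
`7 L(t)³ ‖k_s(·,t)‖₂² ≤ π³` for all `t`, then `L` is non-increasing and
`|e| ≤ L(t) ≤ L(0)` for all `t ∈ [0,T)`. -/
theorem evolution_length {T : ℝ≥0∞} (Φ : SixthFlow T) (e : ℝ) (B : BC Φ e) :
    (∀ t : ℝ, inTime T t →
      HasDerivWithinAt (fun u => clen (Φ.γ u))
          (-(cint (Φ.γ t) (fun x => curv (Φ.γ t) x * speedF (Φ.γ t) x))) (Ici 0) t ∧
      -(cint (Φ.γ t) (fun x => curv (Φ.γ t) x * speedF (Φ.γ t) x))
        = -(knorm2 (Φ.γ t) 2)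
          + 7 / 2 * cint (Φ.γ t) (fun x => (curv (Φ.γ t) x) ^ 2 * (kds (Φ.γ t) 1 x) ^ 2)) ∧
    (∀ t : ℝ, inTime T t → 1 / (2 * π) * totalK (Φ.γ t) = 0 →
      -(cint (Φ.γ t) (fun x => curv (Φ.γ t) x * speedF (Φ.γ t) x))
        ≤ -(1 - 7 * (clen (Φ.γ t)) ^ 3 / π ^ 3 * knorm2 (Φ.γ t) 1) * knorm2 (Φ.γ t) 2) ∧
    ((∀ t : ℝ, inTime T t → 1 / (2 * π) * totalK (Φ.γ t) = 0 ∧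
        7 * (clen (Φ.γ t)) ^ 3 * knorm2 (Φ.γ t) 1 ≤ π ^ 3) →
      (∀ t₁ t₂ : ℝ, inTime T t₁ → inTime T t₂ → t₁ ≤ t₂ →
        clen (Φ.γ t₂) ≤ clen (Φ.γ t₁)) ∧
      (∀ t : ℝ, inTime T t → |e| ≤ clen (Φ.γ t) ∧ clen (Φ.γ t) ≤ clen (Φ.γ 0))) := by
  have hc := fun t => contDiff_slice Φ.smooth t
  have ibp := fun t (ht : inTime T t) => cint_curv_mul_speedF (hc t)
    (fun x hx => Φ.regular ht hx) (B.noflux ht) (B.noflux3 ht)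
  have hderiv : ∀ t : ℝ, inTime T t → HasDerivWithinAt (fun u => clen (Φ.γ u))
      (-(cint (Φ.γ t) (fun x => curv (Φ.γ t) x * speedF (Φ.γ t) x))) (Ici 0) t := by
    intro t ht
    rw [← integral_utangent_mixed Φ.smooth (fun x hx => Φ.regular ht hx) fun x hx =>
      (eq_of_hasDerivWithinAt_Ici ht.1 (Φ.flow ht hx)
        (hasDerivAt_slice_left Φ.smooth t x)).symm]
    exact (hasDerivAt_clen Φ.smooth fun x hx => Φ.regular ht hx).hasDerivWithinAt
  have hbound : ∀ t : ℝ, inTime T t → 1 / (2 * π) * totalK (Φ.γ t) = 0 →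
      -(cint (Φ.γ t) (fun x => curv (Φ.γ t) x * speedF (Φ.γ t) x))
        ≤ -(1 - 7 * (clen (Φ.γ t)) ^ 3 / π ^ 3 * knorm2 (Φ.γ t) 1) * knorm2 (Φ.γ t) 2 := by
    intro t ht hω
    have hK : totalK (Φ.γ t) = 0 := (mul_eq_zero.1 hω).resolve_left (by positivity)
    have h := cint_curv_sq_mul_le (hc t) (fun x hx => Φ.regular ht hx) (B.noflux ht) hK
    have hL := clen_pos (hc t) fun x hx => Φ.regular ht hx
    have n1 := knorm2_nonneg (Φ.γ t) 1
    have n2 := knorm2_nonneg (Φ.γ t) 2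
    have hpi : π ^ 3 ≤ 36 := by
      have : π ^ 3 ≤ 3.15 ^ 3 := pow_le_pow_left₀ pi_pos.le pi_lt_d2.le 3
      exact this.trans (by norm_num)
    have hcmp : clen (Φ.γ t) ^ 3 / 36 ≤ clen (Φ.γ t) ^ 3 / π ^ 3 :=
      div_le_div_of_nonneg_left (by positivity) (by positivity) hpi
    have hcmp' := mul_le_mul_of_nonneg_right hcmp (mul_nonneg n1 n2)
    rw [ibp t ht]
    linear_combination 7 / 2 * h + 7 * hcmp'
  refine ⟨fun t ht => ⟨hderiv t ht, by rw [ibp t ht]; ring⟩, hbound, fun hyp => ?_⟩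
  have mono : ∀ t₁ t₂ : ℝ, inTime T t₁ → inTime T t₂ → t₁ ≤ t₂ →
      clen (Φ.γ t₂) ≤ clen (Φ.γ t₁) := by
    intro t₁ t₂ h₁ h₂ h
    have hin : ∀ t ∈ Icc t₁ t₂, inTime T t := fun t ht =>
      ⟨h₁.1.trans ht.1, (ENNReal.ofReal_le_ofReal ht.2).trans_lt h₂.2⟩
    have hsub : Icc t₁ t₂ ⊆ Ici 0 := fun t ht => (hin t ht).1
    refine antitoneOn_of_hasDerivWithinAt_nonpos (convex_Icc t₁ t₂)
      (f := fun u => clen (Φ.γ u))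
      (f' := fun t => -(cint (Φ.γ t) (fun x => curv (Φ.γ t) x * speedF (Φ.γ t) x)))
      (fun t ht => (hderiv t (hin t ht)).continuousWithinAt.mono hsub)
      (fun t ht => (hderiv t (hin t (interior_subset ht))).mono (interior_subset.trans hsub))
      (fun t ht => ?_) (left_mem_Icc.2 h) (right_mem_Icc.2 h) h
    obtain ⟨hω, hsmall⟩ := hyp t (hin t (interior_subset ht))
    refine (hbound t (hin t (interior_subset ht)) hω).trans ?_
    refine mul_nonpos_of_nonpos_of_nonneg (neg_nonpos.2 (sub_nonneg.2 ?_)) (knorm2_nonneg _ _)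
    rw [div_mul_eq_mul_div, div_le_one (by positivity)]
    exact hsmall
  refine ⟨mono, fun t ht => ⟨?_, mono 0 t ⟨le_rfl, by simpa using Φ.Tpos⟩ ht ht.1⟩⟩
  rw [← B.hdist, ← B.onLeft ht, ← B.onRight ht]
  exact abs_sub_le_clen (hc t)
end
end
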